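/- arXiv:math/0410354 — 4 statements merged into one kernel-verified Lean document; each statement's English description precedes it below -/
import Mathlib

section
/- Under Assumption M and if ω ∈ RV(s) for some s > 0, then for any 0 < ε ≤ 1/2 there exists 0 < η ≤ ε such that P^n_μ(|H_n/h_n − 1| > ε) ≤ 4 exp(−(η²/(1+η/3)) · n F_ν(h_n/2)), where F_ν(h) = ∫₀ʰ ν(t) dt. -/
open MeasureTheory ProbabilityTheory Filter Set Matrix Asymptotics
open scoped ENNReal NNReal

noncomputable section

/-- A continuous positive function is regularly varying at `0` with index `β`. -/
def RegVaryAt0 (ν : ℝ → ℝ) (β : ℝ) : Prop :=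
  (∀ h : ℝ, 0 < h → 0 < ν h) ∧ ContinuousOn ν (Set.Ioi 0) ∧
    ∀ y : ℝ, 0 < y →
      Filter.Tendsto (fun h => ν (y * h) / ν h) (nhdsWithin (0:ℝ) (Set.Ioi 0))
        (nhds (y ^ β))

/-- A non-decreasing continuous positive function is `Γ`-varying at `0` with
continuous positive auxiliary function `ρ`. -/
def GammaVary (ν ρ : ℝ → ℝ) : Prop :=
  (∀ h : ℝ, 0 < h → 0 < ν h) ∧ (∀ h : ℝ, 0 < h → 0 < ρ h) ∧
    ContinuousOn ν (Set.Ioi 0) ∧ ContinuousOn ρ (Set.Ioi 0) ∧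
    MonotoneOn ν (Set.Ioi 0) ∧
    ∀ y : ℝ, Filter.Tendsto (fun h => ν (h + y * ρ h) / ν h)
      (nhdsWithin (0:ℝ) (Set.Ioi 0)) (nhds (Real.exp y))

/-- `F_ν(h) = ∫_0^h ν(t) dt`. -/
def Fnu (ν : ℝ → ℝ) (h : ℝ) : ℝ := ∫ t in (0:ℝ)..h, ν t

/-- `h` is the smallest (positive) solution of `ω(h) = σ / sqrt (2 n F_ν(h))`. -/
def IsSmallestBandwidth (ν ω : ℝ → ℝ) (σ : ℝ) (n : ℕ) (h : ℝ) : Prop :=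
  0 < h ∧ ω h * Real.sqrt (2 * n * Fnu ν h) = σ ∧
    ∀ h' : ℝ, 0 < h' → ω h' * Real.sqrt (2 * n * Fnu ν h') = σ → h ≤ h'

/-- `k = ⌊s⌋`, the largest integer (strictly) smaller than `s` for integer `s`. -/
def kdeg (s : ℝ) : ℕ := ⌈s⌉₊ - 1

/-- The local smoothness class `F_δ(x₀, ω)`: for every `h ≤ δ`, the best local
polynomial approximation of degree `≤ k` on `{|x - x₀| ≤ h}` is at most `ω(h)`. -/
def holderClass (x₀ : ℝ) (ω : ℝ → ℝ) (k : ℕ) (δ : ℝ) : Set (ℝ → ℝ) :=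
  {f | ∀ h : ℝ, 0 < h → h ≤ δ → ∀ ε : ℝ, 0 < ε → ∃ P : Polynomial ℝ,
      P.natDegree ≤ k ∧ ∀ x ∈ Set.Icc (0:ℝ) 1, |x - x₀| ≤ h →
        |f x - P.eval (x - x₀)| ≤ ω h + ε}

/-- `U(α)`, the sup-norm ball of radius `α` for functions on `[0,1]`. -/
def boundedClass (α : ℝ) : Set (ℝ → ℝ) := {f | ∀ x ∈ Set.Icc (0:ℝ) 1, |f x| ≤ α}

/-- `Σ_{δ,α}(x₀,ω) = F_δ(x₀,ω) ∩ U(α)`. -/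
def sigmaClass (x₀ : ℝ) (ω : ℝ → ℝ) (k : ℕ) (δ α : ℝ) : Set (ℝ → ℝ) :=
  holderClass x₀ ω k δ ∩ boundedClass α

/-- The design distribution, with density `μdens` with respect to Lebesgue measure. -/
def designMeasure (μdens : ℝ → ℝ) : Measure ℝ :=
  MeasureTheory.volume.withDensity fun x => ENNReal.ofReal (μdens x)

/-- Joint law `P^n_μ` of the design `X_1, …, X_n` (i.i.d. with density `μdens`). -/
def designLaw (μdens : ℝ → ℝ) (n : ℕ) : Measure (Fin n → ℝ) :=
  Measure.pi fun _ => designMeasure μdens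

/-- Assumption M : near `x₀` the design density is `x ↦ ν |x - x₀|` with `ν`
continuous and positive. -/
def AssumptionM (μdens ν : ℝ → ℝ) (x₀ : ℝ) : Prop :=
  ContinuousOn ν (Set.Ioi 0) ∧ (∀ h : ℝ, 0 < h → 0 < ν h) ∧
    ∃ W ∈ nhds x₀, ∀ x ∈ W, μdens x = ν |x - x₀|

/-- Law of the noise vector `(ξ_1, …, ξ_n)`, i.i.d. centered Gaussian with
variance `σ²`. -/
def noiseLaw (σ : ℝ) (n : ℕ) : Measure (Fin n → ℝ) :=
  Measure.pi fun _ => gaussianReal 0 ⟨σ ^ 2, sq_nonneg σ⟩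

/-- Law of one observation `(X, Y)` with `Y = f(X) + ξ`. -/
def pairLaw (μdens : ℝ → ℝ) (σ : ℝ) (f : ℝ → ℝ) : Measure (ℝ × ℝ) :=
  ((designMeasure μdens).prod (gaussianReal 0 ⟨σ ^ 2, sq_nonneg σ⟩)).map
    fun p => (p.1, f p.1 + p.2)

/-- Joint law `P^n_{f,μ}` of the `n` observations `(X_i, Y_i)`. -/
def jointLaw (μdens : ℝ → ℝ) (σ : ℝ) (f : ℝ → ℝ) (n : ℕ) : Measure (Fin n → ℝ × ℝ) :=
  Measure.pi fun _ => pairLaw μdens σ f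

/-- Pointwise minimax risk (to the power `p`, in `ℝ≥0∞`) over the class `F`:
`(inf_{T} sup_{f ∈ F} E^n_{f,μ} |T - f(x₀)|^p)^{1/p}`, the infimum running over
all measurable estimators. -/
def minimaxRiskE (μdens : ℝ → ℝ) (σ : ℝ) (n : ℕ) (F : Set (ℝ → ℝ)) (x₀ p : ℝ) : ℝ≥0∞ :=
  (⨅ T : {T : (Fin n → ℝ × ℝ) → ℝ // Measurable T},
      ⨆ f ∈ F, ∫⁻ d, ENNReal.ofReal (|T.1 d - f x₀| ^ p) ∂(jointLaw μdens σ f n)) ^ (1 / p)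

/-- `N_{n,h}` : number of design points in `[x₀ - h, x₀ + h]`. -/
def Nnh {n : ℕ} (X : Fin n → ℝ) (x₀ h : ℝ) : ℕ :=
  (Finset.univ.filter fun i => |X i - x₀| ≤ h).card

/-- The data-driven bandwidth `H_n = inf {h ∈ [0,1] : ω(h) ≥ σ / sqrt N_{n,h}}`. -/
def Hband {n : ℕ} (X : Fin n → ℝ) (x₀ σ : ℝ) (ω : ℝ → ℝ) : ℝ :=
  sInf {h : ℝ | h ∈ Set.Icc (0:ℝ) 1 ∧ σ ≤ ω h * Real.sqrt (Nnh X x₀ h)}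

/-- The rectangular kernel `½ 1_{|x| ≤ 1}`. -/
def rectKernel : ℝ → ℝ := fun x => if |x| ≤ 1 then 1 / 2 else 0

/-- Assumption K on the kernel. -/
def AssumptionK (K : ℝ → ℝ) : Prop :=
  K = rectKernel ∨
    ((∀ x, 0 ≤ K x) ∧ (∀ x : ℝ, 1 < |x| → K x = 0) ∧ (∀ x, K (-x) = K x) ∧
      (∀ x, K x ≤ 1) ∧ ∃ C : ℝ, 0 < C ∧ ∃ κ : ℝ, 0 < κ ∧
        ∀ x y : ℝ, |K x - K y| ≤ C * |x - y| ^ κ)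

/-- `K_∞ = sup K`. -/
def kernelSup (K : ℝ → ℝ) : ℝ := ⨆ x, K x

/-- Smallest eigenvalue of a symmetric matrix, via
`λ(M) = inf_{‖x‖ = 1} ⟨x, M x⟩`. -/
def minEig {m : ℕ} (M : Matrix (Fin m) (Fin m) ℝ) : ℝ :=
  sInf {r : ℝ | ∃ x : Fin m → ℝ, (∑ i, x i ^ 2) = 1 ∧ r = x ⬝ᵥ M.mulVec x}

/-- The matrix `X^K_h` with entries `⟨φ_{j,h}, φ_{l,h}⟩_{h,K}`. -/
def XmatK {n : ℕ} (X : Fin n → ℝ) (x₀ h : ℝ) (K : ℝ → ℝ) (k : ℕ) :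
    Matrix (Fin (k + 1)) (Fin (k + 1)) ℝ :=
  Matrix.of fun j l => ∑ i, ((X i - x₀) / h) ^ ((j : ℕ) + (l : ℕ)) * K ((X i - x₀) / h)

/-- The vector `Y^K_h` with entries `⟨Y, φ_{j,h}⟩_{h,K}`. -/
def YvecK {n : ℕ} (X Y : Fin n → ℝ) (x₀ h : ℝ) (K : ℝ → ℝ) (k : ℕ) : Fin (k + 1) → ℝ :=
  fun j => ∑ i, Y i * ((X i - x₀) / h) ^ (j : ℕ) * K ((X i - x₀) / h)

/-- The renormalized matrix `𝒳^K_h = N_{n,h}⁻¹ X^K_h`. -/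
def scalXmat {n : ℕ} (X : Fin n → ℝ) (x₀ h : ℝ) (K : ℝ → ℝ) (k : ℕ) :
    Matrix (Fin (k + 1)) (Fin (k + 1)) ℝ :=
  ((Nnh X x₀ h : ℝ))⁻¹ • XmatK X x₀ h K k

/-- The corrected matrix
`X̃^K_h = X^K_h + N_{n,h}^{1/2} I · 1_{λ(X^K_h) ≤ N_{n,h}^{1/2}}`. -/
def XmatTilde {n : ℕ} (X : Fin n → ℝ) (x₀ h : ℝ) (K : ℝ → ℝ) (k : ℕ) :
    Matrix (Fin (k + 1)) (Fin (k + 1)) ℝ :=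
  XmatK X x₀ h K k +
    (if minEig (XmatK X x₀ h K k) ≤ Real.sqrt (Nnh X x₀ h)
      then Real.sqrt (Nnh X x₀ h) else 0) • (1 : Matrix (Fin (k + 1)) (Fin (k + 1)) ℝ)

/-- The (corrected) local polynomial estimator `f̂_h(x₀) = θ̂₀` where
`X̃^K_h θ̂ = Y^K_h`, and `f̂_h = 0` when `N_{n,h} = 0`. -/
def lpEstim {n : ℕ} (X Y : Fin n → ℝ) (x₀ h : ℝ) (K : ℝ → ℝ) (k : ℕ) : ℝ :=
  if Nnh X x₀ h = 0 then 0 else (XmatTilde X x₀ h K k)⁻¹.mulVec (YvecK X Y x₀ h K k) 0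

/-- The event `Ω^K_h = {λ(𝒳^K_h) > N_{n,h}^{-1/2}, N_{n,h} > 0}`. -/
def goodEvent {n : ℕ} (X : Fin n → ℝ) (x₀ h : ℝ) (K : ℝ → ℝ) (k : ℕ) : Prop :=
  (Real.sqrt (Nnh X x₀ h))⁻¹ < minEig (scalXmat X x₀ h K k) ∧ 0 < Nnh X x₀ h

/-- The constant `m(p) = sqrt(2/π) ∫_0^∞ (1+t)^p e^{-t²/2} dt`. -/
def mconst (p : ℝ) : ℝ :=
  Real.sqrt (2 / Real.pi) * ∫ t in Set.Ioi (0:ℝ), (1 + t) ^ p * Real.exp (-t ^ 2 / 2)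

/-- `K_{n,h,α} = Σ_i ((X_i - x₀)/h)^α K((X_i - x₀)/h)`. -/
def Ksum {n : ℕ} (X : Fin n → ℝ) (x₀ h : ℝ) (α : ℕ) (K : ℝ → ℝ) : ℝ :=
  ∑ i, ((X i - x₀) / h) ^ α * K ((X i - x₀) / h)

/-- The limit matrix `𝒳_{β,K}` with entries
`((β+1)/2)(1+(-1)^{j+l}) ∫_0^1 y^{j+l+β} K(y) dy`. -/
def limitMat (β : ℝ) (K : ℝ → ℝ) (k : ℕ) : Matrix (Fin (k + 1)) (Fin (k + 1)) ℝ :=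
  Matrix.of fun j l => ((β + 1) / 2) * (1 + (-1 : ℝ) ^ ((j : ℕ) + (l : ℕ))) *
    ∫ y in (0:ℝ)..1, y ^ (((j : ℕ) : ℝ) + ((l : ℕ) : ℝ) + β) * K y

/-- Kullback–Leibler divergence `∫ log (dP/dQ) dP`. -/
def KLdiv {α : Type*} [MeasurableSpace α] (P Q : Measure α) : ℝ :=
  ∫ x, Real.log ((P.rnDeriv Q x).toReal) ∂P

/-- Design part of a data sample. -/
def dataX {n : ℕ} (d : Fin n → ℝ × ℝ) : Fin n → ℝ := fun i => (d i).1

/-- Response part of a data sample. -/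
def dataY {n : ℕ} (d : Fin n → ℝ × ℝ) : Fin n → ℝ := fun i => (d i).2

/-- The estimator `f̂_n(x₀) = f̂_{H_n}(x₀)` with the data-driven bandwidth,
as a function of the data. -/
def fhatData {n : ℕ} (d : Fin n → ℝ × ℝ) (x₀ σ : ℝ) (ω K : ℝ → ℝ) (k : ℕ) : ℝ :=
  lpEstim (dataX d) (dataY d) x₀ (Hband (dataX d) x₀ σ ω) K k

/-- If the increments `f (t + u) - f t` of a continuous `f` converge to `-s * u` for every `u`,
then `f` is eventually almost decreasing. This is the uniform convergence theorem of Karamata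
in additive form. -/
lemma exists_forall_add_le_of_tendsto_increments {f : ℝ → ℝ} {s : ℝ} (hf : Continuous f)
    (hs : 0 < s) (hlim : ∀ u, Tendsto (fun t => f (t + u) - f t) atTop (nhds (-s * u)))
    {δ : ℝ} (hδ : 0 < δ) :
    ∃ T : ℝ, ∀ t, T ≤ t → ∀ v, 0 ≤ v → f (t + v) ≤ f t + δ := by
  let A : ℕ → Set ℝ := fun N => {u | ∀ t : ℝ, (N : ℝ) ≤ t → |f (t + u) - f t + s * u| ≤ δ / 2}
  have hA : ∀ N, IsClosed (A N) := by
    intro N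
    simp only [A, Set.ofPred_forall]
    refine isClosed_iInter fun t => isClosed_iInter fun _ => ?_
    exact isClosed_le (by fun_prop) continuous_const
  have hU : ⋃ N, A N = univ := by
    refine Set.eq_univ_of_forall fun u => ?_
    have h1 := Metric.tendsto_atTop.1 (hlim u) (δ / 2) (by linarith)
    obtain ⟨M, hM⟩ := h1
    obtain ⟨N, hN⟩ := exists_nat_ge M
    refine Set.mem_iUnion.2 ⟨N, fun t ht => ?_⟩
    have h2 := hM t (hN.trans ht)
    rw [Real.dist_eq] at h2
    have h3 : f (t + u) - f t + s * u = f (t + u) - f t - -s * u := by ring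
    rw [h3]
    exact h2.le
  obtain ⟨N, a, ha⟩ := nonempty_interior_of_iUnion_of_closed hA hU
  obtain ⟨r, hr, hball⟩ := Metric.isOpen_iff.1 isOpen_interior a ha
  have hmem : ∀ u, |u| < r → a + u ∈ A N := fun u hu =>
    interior_subset (hball (by simpa [Real.dist_eq] using hu))
  set d := r / 2 with hd
  have hd0 : 0 < d := by positivity
  have hsmall : ∀ t, (N : ℝ) + a ≤ t → ∀ u, 0 ≤ u → u ≤ d → f (t + u) ≤ f t + δ := by
    intro t ht u hu0 hud
    have h1 := hmem 0 (by simpa using hr) (t - a) (by linarith)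
    have h2 := hmem u (by rw [abs_of_nonneg hu0]; linarith) (t - a) (by linarith)
    rw [abs_le] at h1 h2
    have e1 : t - a + (a + 0) = t := by ring
    have e2 : t - a + (a + u) = t + u := by ring
    rw [e1] at h1
    rw [e2] at h2
    have : 0 ≤ s * u := by positivity
    nlinarith [h1.1, h2.2]
  have hstep : ∃ M : ℝ, ∀ t, M ≤ t → f (t + d) ≤ f t := by
    have h1 : ∀ᶠ t in atTop, f (t + d) - f t < 0 :=
      (hlim d).eventually_lt_const (by nlinarith)
    obtain ⟨M, hM⟩ := eventually_atTop.1 h1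
    exact ⟨M, fun t ht => by linarith [hM t ht]⟩
  obtain ⟨M, hM⟩ := hstep
  have hiter : ∀ k : ℕ, ∀ t, M ≤ t → f (t + k * d) ≤ f t := by
    intro k
    induction k with
    | zero => intro t _; simp
    | succ k ih =>
      intro t ht
      have h1 := hM (t + k * d) (by have : (0 : ℝ) ≤ k * d := by positivity
                                    linarith)
      have e : t + ((k + 1 : ℕ) : ℝ) * d = t + k * d + d := by push_cast; ring
      rw [e]
      exact h1.trans (ih t ht)
  refine ⟨max M (N + a), fun t ht v hv => ?_⟩
  have hk := Nat.floor_le (div_nonneg hv hd0.le)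
  have hk' := Nat.lt_floor_add_one (v / d)
  set k := ⌊v / d⌋₊
  rw [le_div_iff₀ hd0] at hk
  rw [div_lt_iff₀ hd0] at hk'
  have hkd : (0 : ℝ) ≤ k * d := by positivity
  have h1 := hsmall (t + k * d) (by linarith [le_max_right M (N + a)]) (v - k * d)
    (by linarith) (by linarith)
  have h2 := hiter k t ((le_max_left _ _).trans ht)
  have e : t + k * d + (v - k * d) = t + v := by ring
  rw [e] at h1
  linarith

/-- A function regularly varying at `0` with positive index is almost non-decreasing near `0`. -/
lemma RegVaryAt0.exists_le_mul {ω : ℝ → ℝ} {s : ℝ} (hω : RegVaryAt0 ω s) (hs : 0 < s)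
    {c : ℝ} (hc : 1 < c) :
    ∃ a : ℝ, 0 < a ∧ ∀ h, 0 < h → h ≤ a → ∀ h', 0 < h' → h' ≤ h → ω h' ≤ c * ω h := by
  obtain ⟨hpos, hcont, hlim⟩ := hω
  have hE : Tendsto (fun t : ℝ => Real.exp (-t)) atTop (nhdsWithin 0 (Set.Ioi 0)) :=
    tendsto_nhdsWithin_iff.2 ⟨Real.tendsto_exp_neg_atTop_nhds_zero,
      Eventually.of_forall fun t => Real.exp_pos _⟩
  have hf : Continuous fun t : ℝ => Real.log (ω (Real.exp (-t))) := by
    refine Continuous.log ?_ fun t => (hpos _ (Real.exp_pos _)).ne'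
    exact hcont.comp_continuous (by fun_prop) fun t => Real.exp_pos _
  have hinc : ∀ u : ℝ, Tendsto (fun t : ℝ => Real.log (ω (Real.exp (-(t + u)))) -
      Real.log (ω (Real.exp (-t)))) atTop (nhds (-s * u)) := by
    intro u
    have h1 := ((hlim (Real.exp (-u)) (Real.exp_pos _)).comp hE).log
      (Real.rpow_pos_of_pos (Real.exp_pos _) s).ne'
    have e : Real.log (Real.exp (-u) ^ s) = -s * u := by
      rw [Real.log_rpow (Real.exp_pos _), Real.log_exp]; ring
    rw [e] at h1
    refine h1.congr fun t => ?_
    simp only [Function.comp]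
    rw [← Real.exp_add, show -u + -t = -(t + u) by ring,
      Real.log_div (hpos _ (Real.exp_pos _)).ne' (hpos _ (Real.exp_pos _)).ne']
  obtain ⟨T, hT⟩ := exists_forall_add_le_of_tendsto_increments hf hs hinc (Real.log_pos hc)
  refine ⟨Real.exp (-T), Real.exp_pos _, fun h hh hha h' hh' hle => ?_⟩
  have h1 : T ≤ -Real.log h := by
    have := Real.log_le_log hh hha
    rw [Real.log_exp] at this
    linarith
  have h2 := Real.log_le_log hh' hle
  have h3 := hT (-Real.log h) h1 (Real.log h - Real.log h') (by linarith)
  rw [show -(-Real.log h + (Real.log h - Real.log h')) = Real.log h' by ring, neg_neg,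
    Real.exp_log hh, Real.exp_log hh', add_comm,
    ← Real.log_mul (by linarith) (hpos h hh).ne'] at h3
  exact (Real.log_le_log_iff (hpos _ hh') (mul_pos (by linarith) (hpos _ hh))).1 h3

/-- Exponential Markov inequality for the counting variable `N_{n,h}`. -/
lemma measureReal_pi_le_mul_Nnh (P : Measure ℝ) [IsProbabilityMeasure P] (n : ℕ)
    (x₀ h l c : ℝ) :
    (Measure.pi fun _ : Fin n => P).real {X | c ≤ l * Nnh X x₀ h} ≤
      Real.exp (n * P.real {x | |x - x₀| ≤ h} * (Real.exp l - 1) - c) := by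
  set A : Set ℝ := {x | |x - x₀| ≤ h}
  have hA : MeasurableSet A := measurableSet_le (by fun_prop) measurable_const
  let g : ℝ → ℝ := fun x => 1 + A.indicator (fun _ => Real.exp l - 1) x
  have hgint : Integrable g P :=
    (integrable_const _).add ((integrable_const _).indicator hA)
  have hg : ∫ x, g x ∂P = 1 + P.real A * (Real.exp l - 1) := by
    simp only [g]
    rw [integral_add (integrable_const _) ((integrable_const _).indicator hA),
      integral_indicator_const _ hA]
    simp
  have hprod : ∀ X : Fin n → ℝ, ∏ i, g (X i) = Real.exp (l * Nnh X x₀ h) := by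
    intro X
    have h1 : ∀ i, g (X i) = if |X i - x₀| ≤ h then Real.exp l else 1 := by
      intro i
      simp only [g, Set.indicator, A, Set.mem_ofPred_eq]
      split_ifs <;> ring
    simp_rw [h1]
    rw [Finset.prod_ite, Finset.prod_const, Finset.prod_const_one, mul_one, ← Real.exp_nat_mul,
      mul_comm]
    rfl
  have hint : Integrable (fun X : Fin n → ℝ => ∏ i, g (X i)) (Measure.pi fun _ : Fin n => P) :=
    Integrable.fintype_prod (fun _ => hgint)
  have hval : ∫ X : Fin n → ℝ, ∏ i, g (X i) ∂(Measure.pi fun _ : Fin n => P) =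
      (1 + P.real A * (Real.exp l - 1)) ^ n := by
    rw [integral_fintype_prod_eq_prod (fun _ : Fin n => g)]
    simp [hg]
  have hmk := mul_meas_ge_le_integral_of_nonneg (μ := Measure.pi fun _ : Fin n => P)
    (f := fun X : Fin n → ℝ => ∏ i, g (X i))
    (Eventually.of_forall fun X => by
      change 0 ≤ ∏ i, g (X i)
      rw [hprod]; positivity) hint (Real.exp c)
  rw [hval] at hmk
  simp only [hprod, Real.exp_le_exp] at hmk
  have h0 : 0 ≤ 1 + P.real A * (Real.exp l - 1) := by
    rw [← hg]
    refine integral_nonneg fun x => ?_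
    simp only [g, Set.indicator, Pi.zero_apply]
    split_ifs
    · have := Real.exp_pos l; linarith
    · norm_num
  have h1 : (1 + P.real A * (Real.exp l - 1)) ^ n ≤
      Real.exp (n * P.real A * (Real.exp l - 1)) := by
    rw [mul_assoc, Real.exp_nat_mul]
    refine pow_le_pow_left₀ h0 ?_ n
    rw [add_comm]
    exact Real.add_one_le_exp _
  rw [Real.exp_sub, le_div_iff₀ (Real.exp_pos c), mul_comm]
  exact hmk.trans h1

/-- Chernoff bound for the upper tail of `N_{n,h}`. -/
lemma measureReal_pi_one_add_mul_le_Nnh (P : Measure ℝ) [IsProbabilityMeasure P] (n : ℕ)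
    (x₀ h : ℝ) {η : ℝ} (h0 : 0 ≤ η) (h1 : η ≤ 1) :
    (Measure.pi fun _ : Fin n => P).real
        {X | (1 + η) * (n * P.real {x | |x - x₀| ≤ h}) ≤ Nnh X x₀ h} ≤
      Real.exp (-(η ^ 2 / 4) * (n * P.real {x | |x - x₀| ≤ h})) := by
  set m := (n : ℝ) * P.real {x | |x - x₀| ≤ h} with hm
  have hm0 : 0 ≤ m := by positivity
  refine (measureReal_mono (fun X hX => ?_)).trans
    ((measureReal_pi_le_mul_Nnh P n x₀ h (η / 2) (η / 2 * ((1 + η) * m))).trans ?_)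
  · simp only [Set.mem_ofPred_eq] at hX ⊢
    exact mul_le_mul_of_nonneg_left hX (by linarith)
  · rw [← hm]
    refine Real.exp_le_exp.2 ?_
    have h2 := (abs_le.1 (Real.abs_exp_sub_one_sub_id_le (x := η / 2)
      (by rw [abs_of_nonneg (by linarith)]; linarith))).2
    nlinarith [mul_le_mul_of_nonneg_left h2 hm0]

/-- Chernoff bound for the lower tail of `N_{n,h}`. -/
lemma measureReal_pi_Nnh_le_one_sub_mul (P : Measure ℝ) [IsProbabilityMeasure P] (n : ℕ)
    (x₀ h : ℝ) {η : ℝ} (h0 : 0 ≤ η) (h1 : η ≤ 1) :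
    (Measure.pi fun _ : Fin n => P).real
        {X | (Nnh X x₀ h : ℝ) ≤ (1 - η) * (n * P.real {x | |x - x₀| ≤ h})} ≤
      Real.exp (-(η ^ 2 / 4) * (n * P.real {x | |x - x₀| ≤ h})) := by
  set m := (n : ℝ) * P.real {x | |x - x₀| ≤ h} with hm
  have hm0 : 0 ≤ m := by positivity
  refine (measureReal_mono (fun X hX => ?_)).trans
    ((measureReal_pi_le_mul_Nnh P n x₀ h (-(η / 2)) (-(η / 2) * ((1 - η) * m))).trans ?_)
  · simp only [Set.mem_ofPred_eq] at hX ⊢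
    exact mul_le_mul_of_nonpos_left hX (by linarith)
  · rw [← hm]
    refine Real.exp_le_exp.2 ?_
    have h2 := (abs_le.1 (Real.abs_exp_sub_one_sub_id_le (x := -(η / 2))
      (by rw [abs_neg, abs_of_nonneg (by linarith)]; linarith))).2
    nlinarith [mul_le_mul_of_nonneg_left h2 hm0]

/-- Near `x₀`, the design measure of a symmetric interval of half-width `h` is `2 F_ν(h)`. -/
lemma AssumptionM.exists_designMeasure_real_eq {μdens ν : ℝ → ℝ} {x₀ : ℝ}
    (hM : AssumptionM μdens ν x₀) (hint : Integrable μdens) (hpos : ∀ x, 0 ≤ μdens x) :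
    ∃ δ : ℝ, 0 < δ ∧ IntervalIntegrable ν volume 0 δ ∧ ∀ h, 0 ≤ h → h ≤ δ →
      (designMeasure μdens).real {x | |x - x₀| ≤ h} = 2 * Fnu ν h := by
  obtain ⟨-, -, W, hW, hWν⟩ := hM
  obtain ⟨r, hr, hball⟩ := Metric.mem_nhds_iff.1 hW
  have hν : ∀ x, |x - x₀| < r → μdens x = ν |x - x₀| := fun x hx =>
    hWν x (hball (by simpa [Real.dist_eq] using hx))
  refine ⟨r / 2, by positivity, ?_, fun h h0 hle => ?_⟩
  · have h1 : IntervalIntegrable (fun t => μdens (t + x₀)) volume 0 (r / 2) :=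
      (hint.comp_add_right x₀).intervalIntegrable
    refine h1.congr fun t ht => ?_
    rw [uIoc_of_le (by positivity)] at ht
    have habs : |t + x₀ - x₀| = t := by rw [add_sub_cancel_right, abs_of_pos ht.1]
    change μdens (t + x₀) = ν t
    rw [hν _ (by rw [habs]; linarith [ht.2]), habs]
  · have hset : {x : ℝ | |x - x₀| ≤ h} = Set.Icc (-h + x₀) (h + x₀) := by
      ext x
      simp only [Set.mem_ofPred_eq, Set.mem_Icc, abs_le]
      constructor <;> rintro ⟨h1, h2⟩ <;> constructor <;> linarith
    have hreal : (designMeasure μdens).real (Set.Icc (-h + x₀) (h + x₀)) =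
        ∫ x in (-h + x₀)..(h + x₀), μdens x := by
      rw [intervalIntegral.integral_of_le (by linarith), ← integral_Icc_eq_integral_Ioc,
        integral_eq_lintegral_of_nonneg_ae (Eventually.of_forall hpos)
          hint.aestronglyMeasurable.restrict,
        measureReal_def, designMeasure, withDensity_apply _ measurableSet_Icc]
    have hcomp : IntervalIntegrable (fun t => μdens (t + x₀)) volume (-h) 0 :=
      (hint.comp_add_right x₀).intervalIntegrable
    have hcomp' : IntervalIntegrable (fun t => μdens (t + x₀)) volume 0 h :=
      (hint.comp_add_right x₀).intervalIntegrable
    have hright : ∫ t in (0 : ℝ)..h, μdens (t + x₀) = Fnu ν h := by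
      refine intervalIntegral.integral_congr fun t ht => ?_
      rw [uIcc_of_le h0] at ht
      have habs : |t + x₀ - x₀| = t := by rw [add_sub_cancel_right, abs_of_nonneg ht.1]
      change μdens (t + x₀) = ν t
      rw [hν _ (by rw [habs]; linarith [ht.2]), habs]
    have hleft : ∫ t in (-h)..0, μdens (t + x₀) = Fnu ν h := by
      have h1 := intervalIntegral.integral_comp_neg (a := 0) (b := h)
        (fun t => μdens (t + x₀))
      rw [neg_zero] at h1
      rw [← h1]
      refine intervalIntegral.integral_congr fun t ht => ?_
      rw [uIcc_of_le h0] at ht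
      have habs : |-t + x₀ - x₀| = t := by
        rw [add_sub_cancel_right, abs_neg, abs_of_nonneg ht.1]
      change μdens (-t + x₀) = ν t
      rw [hν _ (by rw [habs]; linarith [ht.2]), habs]
    rw [hset, hreal, ← intervalIntegral.integral_comp_add_right,
      ← intervalIntegral.integral_add_adjacent_intervals hcomp hcomp', hright, hleft, two_mul]

lemma Fnu_mono {ν : ℝ → ℝ} {δ a b : ℝ} (hν : IntervalIntegrable ν volume 0 δ)
    (hpos : ∀ h, 0 < h → 0 < ν h) (ha : 0 ≤ a) (hab : a ≤ b) (hb : b ≤ δ) :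
    Fnu ν a ≤ Fnu ν b := by
  have h1 : IntervalIntegrable ν volume 0 a := hν.mono_set <| by
    rw [uIcc_of_le ha, uIcc_of_le (by linarith)]
    exact Set.Icc_subset_Icc_right (by linarith)
  have h2 : IntervalIntegrable ν volume a b := hν.mono_set <| by
    rw [uIcc_of_le hab, uIcc_of_le (by linarith)]
    exact Set.Icc_subset_Icc ha hb
  have h3 := intervalIntegral.integral_add_adjacent_intervals h1 h2
  have h4 : 0 ≤ ∫ t in a..b, ν t := by
    rw [intervalIntegral.integral_of_le hab]
    exact setIntegral_nonneg measurableSet_Ioc fun t ht => (hpos t (ha.trans_lt ht.1)).le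
  simp only [Fnu]
  linarith

lemma Fnu_pos {ν : ℝ → ℝ} {δ h : ℝ} (hν : IntervalIntegrable ν volume 0 δ)
    (hpos : ∀ h, 0 < h → 0 < ν h) (h0 : 0 < h) (hle : h ≤ δ) : 0 < Fnu ν h := by
  refine intervalIntegral.intervalIntegral_pos_of_pos_on (hν.mono_set ?_)
    (fun t ht => hpos t ht.1) h0
  rw [uIcc_of_le h0.le, uIcc_of_le (by linarith)]
  exact Set.Icc_subset_Icc_right hle

/-- The deterministic bandwidths `h_n` tend to `0`. -/
lemma tendsto_bandwidth_zero {ν ω : ℝ → ℝ} {σ s δ : ℝ} (hs : 0 < s) (hσ : 0 < σ) (hδ : 0 < δ)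
    (hν : IntervalIntegrable ν volume 0 δ) (hpos : ∀ h, 0 < h → 0 < ν h)
    (hω : RegVaryAt0 ω s) {hseq : ℕ → ℝ}
    (hband : ∀ n : ℕ, 0 < n → IsSmallestBandwidth ν ω σ n (hseq n)) :
    Tendsto hseq atTop (nhds 0) := by
  have hF : ContinuousOn (Fnu ν) (Set.Icc 0 δ) := by
    have h1 := intervalIntegral.continuousOn_primitive_interval' hν left_mem_uIcc
    rwa [uIcc_of_le hδ.le] at h1
  have key : ∀ r : ℝ, 0 < r → r ≤ δ → ∀ᶠ n : ℕ in atTop, hseq n ≤ r := by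
    intro r hr hrδ
    have hFr := Fnu_pos hν hpos hr hrδ
    have hωr := hω.1 r hr
    have hlarge : ∀ᶠ n : ℕ in atTop, σ ^ 2 / (2 * Fnu ν r * ω r ^ 2) ≤ n :=
      tendsto_natCast_atTop_atTop.eventually_ge_atTop _
    filter_upwards [hlarge, eventually_gt_atTop 0] with n hn hn0
    have hφr : σ ≤ ω r * Real.sqrt (2 * n * Fnu ν r) := by
      rw [div_le_iff₀ (by positivity)] at hn
      refine le_of_sq_le_sq ?_ (by positivity)
      rw [mul_pow, Real.sq_sqrt (by positivity)]
      linarith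
    have hsmall : ∃ a, 0 < a ∧ a ≤ r ∧ ω a * Real.sqrt (2 * n * Fnu ν a) ≤ σ := by
      obtain ⟨b, hb, hbω⟩ := hω.exists_le_mul hs (c := 2) (by norm_num)
      have hωb := hω.1 b hb
      have hF0 : Tendsto (fun h => 2 * ω b * Real.sqrt (2 * n * Fnu ν h))
          (nhdsWithin 0 (Set.Ioc 0 δ)) (nhds 0) := by
        have h1 : Tendsto (Fnu ν) (nhdsWithin 0 (Set.Ioc 0 δ)) (nhds 0) := by
          have h2 := (hF 0 ⟨le_rfl, hδ.le⟩).mono_left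
            (nhdsWithin_mono 0 Set.Ioc_subset_Icc_self)
          simpa [Fnu] using h2
        simpa using ((h1.const_mul (2 * (n : ℝ))).sqrt).const_mul (2 * ω b)
      rw [nhdsWithin_Ioc_eq_nhdsGT hδ] at hF0
      have hev := (hF0.eventually_lt_const hσ).and
        (Ioc_mem_nhdsGT (lt_min hb hr) : Set.Ioc 0 (min b r) ∈ nhdsWithin 0 (Set.Ioi (0 : ℝ)))
      obtain ⟨a, ha1, ha0, ha2⟩ := hev.exists
      refine ⟨a, ha0, ha2.trans (min_le_right _ _), le_trans ?_ ha1.le⟩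
      exact mul_le_mul_of_nonneg_right (hbω b hb le_rfl a ha0 (ha2.trans (min_le_left _ _)))
        (Real.sqrt_nonneg _)
    obtain ⟨a, ha0, har, haσ⟩ := hsmall
    have hcont : ContinuousOn (fun h => ω h * Real.sqrt (2 * n * Fnu ν h)) (Set.Icc a r) := by
      refine (hω.2.1.mono fun x hx => ha0.trans_le hx.1).mul ?_
      exact ((hF.mono (Set.Icc_subset_Icc ha0.le hrδ)).const_mul _).sqrt
    obtain ⟨h', hh', heq⟩ := intermediate_value_Icc har hcont ⟨haσ, hφr⟩
    exact ((hband n hn0).2.2 h' (ha0.trans_le hh'.1) heq).trans hh'.2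
  refine tendsto_order.2 ⟨fun b hb => ?_, fun b hb => ?_⟩
  · filter_upwards [eventually_gt_atTop 0] with n hn
    exact hb.trans (hband n hn).1
  · filter_upwards [key (min (b / 2) δ) (lt_min (by linarith) hδ) (min_le_right _ _)] with n hn
    have := hn.trans (min_le_left _ _)
    linarith

/-- Quantitative comparison of `ω` near `h` with its values at `(1 + ε) h` and below
`(1 - ε) h`. -/
lemma RegVaryAt0.exists_sq_comparison {ω : ℝ → ℝ} {s : ℝ} (hω : RegVaryAt0 ω s) (hs : 0 < s)
    {ε : ℝ} (h0 : 0 < ε) (h1 : ε < 1) :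
    ∃ η : ℝ, 0 < η ∧ η ≤ ε ∧ ∃ a : ℝ, 0 < a ∧ ∀ h, 0 < h → h ≤ a →
      ω h ^ 2 ≤ (1 - η) * ω ((1 + ε) * h) ^ 2 ∧
      ∀ h', 0 < h' → h' ≤ (1 - ε) * h → (1 + η) * ω h' ^ 2 ≤ ω h ^ 2 := by
  have hY : 1 < ((1 + ε) ^ s) ^ 2 :=
    one_lt_pow₀ (Real.one_lt_rpow (by linarith) hs) two_ne_zero
  have hZ : ((1 - ε) ^ s) ^ 2 < 1 :=
    pow_lt_one₀ (Real.rpow_nonneg (by linarith) s)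
      (Real.rpow_lt_one (by linarith) (by linarith) hs) two_ne_zero
  set Y := ((1 + ε) ^ s) ^ 2
  set Z := ((1 - ε) ^ s) ^ 2
  have hη : ∃ η : ℝ, (0 < η ∧ η ≤ ε) ∧ 1 < (1 - η) * Y ∧ (1 + η) * ((1 + η) ^ 2 * Z) < 1 := by
    have l1 : Tendsto (fun η : ℝ => (1 - η) * Y) (nhdsWithin 0 (Set.Ioi 0)) (nhds Y) := by
      have : Continuous fun η : ℝ => (1 - η) * Y := by fun_prop
      simpa using (this.tendsto 0).mono_left nhdsWithin_le_nhds
    have l2 : Tendsto (fun η : ℝ => (1 + η) * ((1 + η) ^ 2 * Z)) (nhdsWithin 0 (Set.Ioi 0))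
        (nhds Z) := by
      have : Continuous fun η : ℝ => (1 + η) * ((1 + η) ^ 2 * Z) := by fun_prop
      simpa using (this.tendsto 0).mono_left nhdsWithin_le_nhds
    have hev : ∀ᶠ η : ℝ in nhdsWithin 0 (Set.Ioi 0), 0 < η ∧ η ≤ ε := Ioc_mem_nhdsGT h0
    exact (hev.and ((l1.eventually_const_lt hY).and (l2.eventually_lt_const hZ))).exists
  obtain ⟨η, ⟨hη0, hηε⟩, hηY, hηZ⟩ := hη
  obtain ⟨b, hb, hbω⟩ := hω.exists_le_mul hs (c := 1 + η) (by linarith)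
  have lim1 := ((hω.2.2 (1 + ε) (by linarith)).pow 2).const_mul (1 - η)
  have lim2 := (((hω.2.2 (1 - ε) (by linarith)).pow 2).const_mul ((1 + η) ^ 2)).const_mul (1 + η)
  obtain ⟨a, ha, hsub⟩ := mem_nhdsGT_iff_exists_Ioc_subset.1
    ((lim1.eventually_const_lt hηY).and (lim2.eventually_lt_const hηZ))
  refine ⟨η, hη0, hηε, min a b, lt_min ha hb, fun h hh hle => ?_⟩
  obtain ⟨c1, c2⟩ := hsub ⟨hh, hle.trans (min_le_left _ _)⟩
  have hωh := hω.1 h hh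
  simp only [div_pow] at c1 c2
  have hωh2 : 0 < ω h ^ 2 := by positivity
  rw [← mul_div_assoc, lt_div_iff₀ hωh2] at c1
  rw [← mul_div_assoc, ← mul_div_assoc, div_lt_iff₀ hωh2] at c2
  refine ⟨by linarith, fun h' hh' hle' => ?_⟩
  have hb' : (1 - ε) * h ≤ b := by nlinarith [hle.trans (min_le_right a b)]
  have c3 := hbω ((1 - ε) * h) (hh'.trans_le hle') hb' h' hh' hle'
  have c4 := pow_le_pow_left₀ (hω.1 h' hh').le c3 2
  rw [mul_pow] at c4
  have c5 := mul_le_mul_of_nonneg_left c4 (by linarith : 0 ≤ 1 + η)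
  linarith

lemma Nnh_mono {n : ℕ} (X : Fin n → ℝ) (x₀ : ℝ) {h h' : ℝ} (hle : h ≤ h') :
    Nnh X x₀ h ≤ Nnh X x₀ h' :=
  Finset.card_le_card fun i hi => by
    simp only [Finset.mem_filter, Finset.mem_univ, true_and] at hi ⊢
    exact hi.trans hle

/-- If the counts at `(1 + ε) h` and `(1 - ε) h` are close to their means, the data-driven
bandwidth lies within relative distance `ε` of `h`. -/
lemma abs_Hband_div_sub_one_le {n : ℕ} {X : Fin n → ℝ} {x₀ σ ε η h A m₁ m₂ : ℝ} {ω : ℝ → ℝ}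
    (hX : ∀ i, X i ≠ x₀) (hσ : 0 < σ) (hωpos : ∀ h, 0 < h → 0 < ω h) (hε : 0 < ε)
    (hε1 : ε < 1) (hη0 : 0 ≤ η) (hη1 : η ≤ 1) (hh : 0 < h) (hh1 : (1 + ε) * h ≤ 1) (hA : 0 ≤ A)
    (hAσ : ω h * Real.sqrt A = σ) (hm₁ : A ≤ m₁) (hm₂ : m₂ ≤ A)
    (hup : ω h ^ 2 ≤ (1 - η) * ω ((1 + ε) * h) ^ 2)
    (hlow : ∀ h', 0 < h' → h' ≤ (1 - ε) * h → (1 + η) * ω h' ^ 2 ≤ ω h ^ 2)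
    (hN₁ : (1 - η) * m₁ < Nnh X x₀ ((1 + ε) * h))
    (hN₂ : Nnh X x₀ ((1 - ε) * h) < (1 + η) * m₂) :
    |Hband X x₀ σ ω / h - 1| ≤ ε := by
  have hσ2 : σ ^ 2 = ω h ^ 2 * A := by rw [← hAσ, mul_pow, Real.sq_sqrt hA]
  have hmem : (1 + ε) * h ∈
      {h : ℝ | h ∈ Set.Icc (0:ℝ) 1 ∧ σ ≤ ω h * Real.sqrt (Nnh X x₀ h)} := by
    have hω1 := hωpos ((1 + ε) * h) (by positivity)
    refine ⟨⟨by positivity, hh1⟩, le_of_sq_le_sq ?_ (by positivity)⟩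
    rw [mul_pow, Real.sq_sqrt (Nat.cast_nonneg _), hσ2]
    calc ω h ^ 2 * A ≤ (1 - η) * ω ((1 + ε) * h) ^ 2 * m₁ :=
          mul_le_mul hup hm₁ hA (mul_nonneg (by linarith) (sq_nonneg _))
      _ = ω ((1 + ε) * h) ^ 2 * ((1 - η) * m₁) := by ring
      _ ≤ _ := mul_le_mul_of_nonneg_left hN₁.le (sq_nonneg _)
  have hle : Hband X x₀ σ ω ≤ (1 + ε) * h := csInf_le ⟨0, fun x hx => hx.1.1⟩ hmem
  have hge : (1 - ε) * h ≤ Hband X x₀ σ ω := by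
    refine le_csInf ⟨_, hmem⟩ fun b hb => ?_
    obtain ⟨⟨hb0, -⟩, hbσ⟩ := hb
    by_contra! hlt
    rcases hb0.eq_or_lt with rfl | hb0
    · have : Nnh X x₀ 0 = 0 := by
        simp only [Nnh, Finset.card_eq_zero, Finset.filter_eq_empty_iff]
        intro i _ hi
        exact hX i (sub_eq_zero.1 (abs_eq_zero.1 (le_antisymm hi (abs_nonneg _))))
      rw [this] at hbσ
      simp at hbσ
      linarith
    · have h1 := pow_le_pow_left₀ hσ.le hbσ 2
      rw [mul_pow, Real.sq_sqrt (Nat.cast_nonneg _), hσ2] at h1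
      have hN : (Nnh X x₀ b : ℝ) < (1 + η) * m₂ :=
        lt_of_le_of_lt (by exact_mod_cast Nnh_mono X x₀ hlt.le) hN₂
      have hω2 : 0 < ω b ^ 2 := by have := hωpos b hb0; positivity
      have h2 := mul_lt_mul_of_pos_left hN hω2
      have h3 := mul_le_mul_of_nonneg_right (hlow b hb0 hlt.le) hA
      have h4 := mul_le_mul_of_nonneg_left hm₂
        (mul_nonneg (by linarith : 0 ≤ 1 + η) hω2.le)
      linarith
  rw [abs_le, div_sub_one hh.ne', le_div_iff₀ hh, div_le_iff₀ hh]
  constructor <;> linarith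

/-- Almost surely, no design point equals `x₀`. -/
lemma ae_designLaw_ne (μdens : ℝ → ℝ) [IsProbabilityMeasure (designMeasure μdens)] (n : ℕ)
    (x₀ : ℝ) : ∀ᵐ X ∂(designLaw μdens n), ∀ i, X i ≠ x₀ := by
  rw [ae_all_iff]
  intro i
  have h1 : ∀ᵐ x ∂(designMeasure μdens), x ≠ x₀ :=
    (withDensity_absolutelyContinuous _ _).ae_le (Measure.ae_ne volume x₀)
  exact (Measure.quasiMeasurePreserving_eval (fun _ : Fin n => designMeasure μdens) i).ae h1

/-- Proposition 2: concentration of the data-driven bandwidth `H_n`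
around the deterministic bandwidth `h_n`. -/
theorem statement3 (μdens ν ω : ℝ → ℝ) (x₀ σ s : ℝ) (hs : 0 < s) (hσ : 0 < σ)
    (hM : AssumptionM μdens ν x₀)
    (hmeas : Measurable μdens) (hpos : ∀ x, 0 ≤ μdens x)
    (hprob : IsProbabilityMeasure (designMeasure μdens))
    (hω : RegVaryAt0 ω s)
    (hseq : ℕ → ℝ) (hband : ∀ n : ℕ, 0 < n → IsSmallestBandwidth ν ω σ n (hseq n)) :
    ∀ ε : ℝ, 0 < ε → ε ≤ 1 / 2 → ∃ η : ℝ, 0 < η ∧ η ≤ ε ∧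
      ∀ n : ℕ, 0 < n →
        designLaw μdens n {X | ε < |Hband X x₀ σ ω / hseq n - 1|} ≤
          ENNReal.ofReal
            (4 * Real.exp (-(η ^ 2 / (1 + η / 3)) * n * Fnu ν (hseq n / 2))) := by
  intro ε hε hε2
  have hint : Integrable μdens := by
    refine ⟨hmeas.aestronglyMeasurable, ?_⟩
    rw [hasFiniteIntegral_iff_ofReal (Eventually.of_forall hpos), ← setLIntegral_univ,
      ← withDensity_apply _ MeasurableSet.univ]
    exact measure_lt_top (designMeasure μdens) univ
  have hνpos := hM.2.1
  obtain ⟨δ, hδ, hν, hreal⟩ := hM.exists_designMeasure_real_eq hint hpos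
  obtain ⟨η₁, hη₁, hη₁ε, a, ha, hcomp⟩ := hω.exists_sq_comparison hs hε (by linarith)
  have hlim := tendsto_bandwidth_zero hs hσ hδ hν hνpos hω hband
  obtain ⟨n₀, hn₀⟩ := eventually_atTop.1
    (hlim.eventually_le_const (lt_min ha (lt_min (half_pos hδ) (half_pos one_pos))))
  obtain ⟨M, hMb⟩ := ((Finset.range n₀).image fun n : ℕ => n * Fnu ν (hseq n / 2)).exists_le
  set K := max M 1
  have hK : 0 < K := lt_max_of_lt_right one_pos
  set η := min (η₁ / 2) (1 / K)
  have hη : 0 < η := lt_min (by linarith) (by positivity)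
  have hηη₁ : η ≤ η₁ / 2 := min_le_left _ _
  have hrate : η ^ 2 / (1 + η / 3) ≤ η ^ 2 := div_le_self (sq_nonneg _) (by linarith)
  refine ⟨η, hη, by linarith, fun n hn => ?_⟩
  have : IsProbabilityMeasure (designLaw μdens n) := by
    unfold designLaw; infer_instance
  rcases lt_or_ge n n₀ with hlt | hge
  · refine prob_le_one.trans (ENNReal.one_le_ofReal.2 ?_)
    have h1 : n * Fnu ν (hseq n / 2) ≤ K :=
      (hMb _ (Finset.mem_image_of_mem _ (Finset.mem_range.2 hlt))).trans (le_max_left _ _)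
    have h2 : η * K ≤ 1 := (le_div_iff₀ hK).1 (min_le_right _ _)
    have h3 : η ^ 2 / (1 + η / 3) * (n * Fnu ν (hseq n / 2)) ≤ 1 := by
      have h4 : 0 ≤ η ^ 2 / (1 + η / 3) := by positivity
      have h5 := mul_le_mul_of_nonneg_left h1 h4
      have h6 := mul_le_mul_of_nonneg_right hrate hK.le
      nlinarith
    have h4 : Real.exp (-1) ≤ Real.exp (-(η ^ 2 / (1 + η / 3)) * n * Fnu ν (hseq n / 2)) :=
      Real.exp_le_exp.2 (by linarith)
    have h5 : (1 : ℝ) / 3 ≤ Real.exp (-1) := by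
      rw [Real.exp_neg, ← one_div]
      exact one_div_le_one_div_of_le (Real.exp_pos _) (by linarith [Real.exp_one_lt_d9])
    linarith
  · obtain ⟨hh, hhσ, -⟩ := hband n hn
    have hle := hn₀ n hge
    set h := hseq n
    have hha : h ≤ a := hle.trans (min_le_left _ _)
    have hhδ : h ≤ δ / 2 := hle.trans ((min_le_right _ _).trans (min_le_left _ _))
    have hh1 : h ≤ 1 / 2 := hle.trans ((min_le_right _ _).trans (min_le_right _ _))
    obtain ⟨hup, hlow⟩ := hcomp h hh hha
    have hεh : 0 < ε * h := by positivity
    have hεh' : ε * h ≤ h / 2 := by nlinarith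
    have hr₁ := hreal ((1 + ε) * h) (by nlinarith) (by linarith)
    have hr₂ := hreal ((1 - ε) * h) (by nlinarith) (by linarith)
    have hF₀ := Fnu_pos hν hνpos (half_pos hh) (by linarith)
    have hF₁ := Fnu_mono hν hνpos hh.le (by linarith : h ≤ (1 + ε) * h) (by linarith)
    have hF₂ := Fnu_mono hν hνpos (by nlinarith) (by linarith : (1 - ε) * h ≤ h) (by linarith)
    have hF₃ := Fnu_mono hν hνpos (half_pos hh).le (by linarith : h / 2 ≤ (1 - ε) * h)
      (by linarith)
    have hup₁ := measureReal_pi_Nnh_le_one_sub_mul (designMeasure μdens) n x₀ ((1 + ε) * h)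
      hη₁.le (by linarith)
    have hlow₁ := measureReal_pi_one_add_mul_le_Nnh (designMeasure μdens) n x₀ ((1 - ε) * h)
      hη₁.le (by linarith)
    rw [hr₁] at hup₁
    rw [hr₂] at hlow₁
    set E₁ : Set (Fin n → ℝ) := {X | (Nnh X x₀ ((1 + ε) * h) : ℝ) ≤
      (1 - η₁) * (n * (2 * Fnu ν ((1 + ε) * h)))}
    set E₂ : Set (Fin n → ℝ) := {X | (1 + η₁) * (n * (2 * Fnu ν ((1 - ε) * h))) ≤
      Nnh X x₀ ((1 - ε) * h)}
    have hn' : (0 : ℝ) < n := Nat.cast_pos.2 hn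
    have hm : 0 ≤ 2 * n * Fnu ν h := mul_nonneg (by positivity) (by linarith)
    have hm₁ := mul_le_mul_of_nonneg_left hF₁ (by positivity : (0 : ℝ) ≤ 2 * n)
    have hm₂ := mul_le_mul_of_nonneg_left hF₂ (by positivity : (0 : ℝ) ≤ 2 * n)
    have hsub : ∀ᵐ X ∂(designLaw μdens n),
        X ∈ {X | ε < |Hband X x₀ σ ω / h - 1|} → X ∈ E₁ ∪ E₂ := by
      filter_upwards [ae_designLaw_ne μdens n x₀] with X hX hXε
      by_contra hnot
      have hnot₁ : X ∉ E₁ := fun hc => hnot (Or.inl hc)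
      have hnot₂ : X ∉ E₂ := fun hc => hnot (Or.inr hc)
      refine absurd (abs_Hband_div_sub_one_le hX hσ hω.1 hε (by linarith) hη₁.le (by linarith) hh
        (by linarith) hm hhσ (by linarith) (by linarith) hup hlow
        (not_le.1 hnot₁) (not_le.1 hnot₂)) (not_le.2 hXε)
    have hexp : ∀ F, Fnu ν (h / 2) ≤ F → Real.exp (-(η₁ ^ 2 / 4) * (n * (2 * F))) ≤
        Real.exp (-(η ^ 2 / (1 + η / 3)) * n * Fnu ν (h / 2)) := by
      intro F hF
      refine Real.exp_le_exp.2 ?_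
      have h1 : η ^ 2 ≤ η₁ ^ 2 / 4 := by nlinarith
      have h2 : n * Fnu ν (h / 2) ≤ n * F := mul_le_mul_of_nonneg_left hF hn'.le
      have h3 : 0 ≤ n * Fnu ν (h / 2) := by positivity
      have h4 := mul_le_mul_of_nonneg_right (hrate.trans h1) h3
      have h5 := mul_le_mul_of_nonneg_left h2 (by positivity : 0 ≤ η₁ ^ 2 / 4)
      have h6 := mul_nonneg (by positivity : 0 ≤ η₁ ^ 2 / 4) h3
      linarith
    have hb₁ := hup₁.trans (hexp _ (by linarith))
    have hb₂ := hlow₁.trans (hexp _ hF₃)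
    calc designLaw μdens n {X | ε < |Hband X x₀ σ ω / h - 1|}
        ≤ designLaw μdens n (E₁ ∪ E₂) := measure_mono_ae hsub
      _ = ENNReal.ofReal ((designLaw μdens n).real (E₁ ∪ E₂)) := by
          rw [ofReal_measureReal]
      _ ≤ _ := by
          refine ENNReal.ofReal_le_ofReal ((measureReal_union_le _ _).trans ?_)
          have h0 := Real.exp_pos (-(η ^ 2 / (1 + η / 3)) * n * Fnu ν (h / 2))
          have hb₁' : (designLaw μdens n).real E₁ ≤ _ := hb₁
          have hb₂' : (designLaw μdens n).real E₂ ≤ _ := hb₂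
          linarith

end
end

section
/- Let h_n be the smallest solution of ω(h) = σ/√(2nF_ν(h)), r_n = ω(h_n), and let (α_n) be a sequence of positive numbers tending to +∞. For the class Σ = Σ_{h_n,α_n}(x₀,ω), the pointwise minimax risk satisfies liminf_n r_n^{−1} R_n(Σ,μ) ≥ C_{s,p} for some constant C_{s,p} > 0 depending only on s and p. -/
open MeasureTheory ProbabilityTheory Filter Set Matrix Asymptotics
open scoped ENNReal NNReal

noncomputable section

theorem RegVaryAt0.tendsto_zero {ω : ℝ → ℝ} {s : ℝ} (hs : 0 < s) (hω : RegVaryAt0 ω s) :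
    Tendsto ω (nhdsWithin 0 (Ioi 0)) (nhds 0) := by
  obtain ⟨hpos, hcont, hlim⟩ := hω
  set G : ℝ → ℝ := fun t => ω (Real.exp (-t)) with hG
  have hGpos : ∀ t, 0 < G t := fun t => hpos _ (Real.exp_pos _)
  have hGc : Continuous G :=
    hcont.comp_continuous (by fun_prop) fun t => Real.exp_pos _
  have hexp : Tendsto (fun t : ℝ => Real.exp (-t)) atTop (nhdsWithin 0 (Ioi 0)) :=
    tendsto_nhdsWithin_iff.2 ⟨Real.tendsto_exp_neg_atTop_nhds_zero,
      Eventually.of_forall fun t => Real.exp_pos _⟩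
  have hratio : ∀ u : ℝ, Tendsto (fun t => G (t + u) / G t) atTop (nhds (Real.exp (-(s * u)))) := by
    intro u
    have h := (hlim (Real.exp (-u)) (Real.exp_pos _)).comp hexp
    rw [← Real.exp_mul] at h
    convert h using 2 with t
    · simp only [hG, Function.comp, ← Real.exp_add]
      congr 3; ring
    · ring_nf
  let E : ℕ → Set ℝ := fun N =>
    {u | ∀ t : ℝ, (N : ℝ) ≤ t → G (t + u) ≤ (Real.exp (-(s * u)) + 1) * G t}
  have hEclosed : ∀ N, IsClosed (E N) := by
    intro N
    simp only [E, ofPred_forall]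
    refine isClosed_iInter fun t => isClosed_iInter fun _ => isClosed_le ?_ ?_ <;> fun_prop
  have hEunion : ⋃ N, E N = univ := by
    refine eq_univ_of_forall fun u => ?_
    have h := (hratio u).eventually (gt_mem_nhds (lt_add_one _))
    obtain ⟨T, hT⟩ := eventually_atTop.1 h
    refine mem_iUnion.2 ⟨⌈T⌉₊, fun t ht => ?_⟩
    exact ((div_lt_iff₀ (hGpos t)).1 (hT t ((Nat.le_ceil T).trans ht))).le
  obtain ⟨N, a₀, ha₀⟩ := nonempty_interior_of_iUnion_of_closed hEclosed hEunion
  obtain ⟨ε, hε, hball⟩ := Metric.isOpen_iff.1 isOpen_interior a₀ ha₀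
  set d := ε / 2
  have hd : 0 < d := half_pos hε
  have hIcc : ∀ u, a₀ ≤ u → u ≤ a₀ + d → u ∈ E N := fun u h1 h2 =>
    interior_subset (hball (by
      rw [Metric.mem_ball, Real.dist_eq, abs_of_nonneg (by linarith)]
      have : d < ε := half_lt_self hε
      linarith))
  set K := Real.exp (-(s * a₀)) + 1
  have hK : 0 < K := by positivity
  have hseq : Tendsto (fun j : ℕ => G (N + j * d)) atTop (nhds 0) := by
    refine Summable.tendsto_atTop_zero (summable_of_ratio_test_tendsto_lt_one
      (l := Real.exp (-(s * d))) ?_ ?_ ?_)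
    · rw [Real.exp_lt_one_iff]
      have := mul_pos hs hd
      linarith
    · exact Eventually.of_forall fun j => (hGpos _).ne'
    · have h1 : Tendsto (fun j : ℕ => (N : ℝ) + j * d) atTop atTop :=
        tendsto_atTop_add_const_left _ _ (tendsto_natCast_atTop_atTop.atTop_mul_const hd)
      refine ((hratio d).comp h1).congr fun j => ?_
      simp only [Function.comp, Real.norm_of_nonneg (hGpos _).le]
      congr 2
      push_cast; ring
  have hGlim : Tendsto G atTop (nhds 0) := by
    rw [Metric.tendsto_atTop]
    intro η hη
    obtain ⟨J, hJ⟩ := eventually_atTop.1 (hseq.eventually (gt_mem_nhds (div_pos hη hK)))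
    refine ⟨N + a₀ + J * d, fun x hx => ?_⟩
    rw [Real.dist_eq, sub_zero, abs_of_pos (hGpos x)]
    have h0 : (J : ℝ) ≤ (x - a₀ - N) / d := by
      rw [le_div_iff₀ hd]; linarith
    set j := ⌊(x - a₀ - N) / d⌋₊
    have hJj : J ≤ j := Nat.le_floor h0
    have hj1 : j * d ≤ x - a₀ - N :=
      (le_div_iff₀ hd).1 (Nat.floor_le ((Nat.cast_nonneg J).trans h0))
    have hj2 : x - a₀ - N < (j + 1) * d := (div_lt_iff₀ hd).1 (Nat.lt_floor_add_one _)
    have hmem := hIcc (x - (N + j * d)) (by linarith) (by linarith) (N + j * d)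
      (by have : 0 ≤ j * d := by positivity
          linarith)
    rw [add_sub_cancel] at hmem
    have hle : Real.exp (-(s * (x - (N + j * d)))) + 1 ≤ K := by
      refine add_le_add_left (Real.exp_le_exp.2 (neg_le_neg ?_)) 1
      exact mul_le_mul_of_nonneg_left (by linarith) hs.le
    calc G x ≤ K * G (N + j * d) := hmem.trans (by gcongr; exact (hGpos _).le)
      _ < K * (η / K) := by gcongr; exact hJ j hJj
      _ = η := by field_simp
  have hlog : Tendsto (fun h => -Real.log h) (nhdsWithin 0 (Ioi 0)) atTop :=
    tendsto_neg_atBot_atTop.comp Real.tendsto_log_nhdsGT_zero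
  refine (hGlim.comp hlog).congr' ?_
  filter_upwards [self_mem_nhdsWithin] with h hh
  simp only [hG, Function.comp, neg_neg]
  rw [Real.exp_log hh]

theorem sq_lintegral_mul_le {α : Type*} [MeasurableSpace α] (μ : Measure α) {f g : α → ℝ≥0∞}
    (hf : Measurable f) (hg : Measurable g) :
    (∫⁻ x, f x * g x ∂μ) ^ 2 ≤ (∫⁻ x, f x ^ 2 ∂μ) * ∫⁻ x, g x ^ 2 ∂μ := by
  have h := ENNReal.lintegral_mul_le_Lp_mul_Lq μ Real.HolderConjugate.two_two
    hf.aemeasurable hg.aemeasurable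
  simp only [Pi.mul_apply, ENNReal.rpow_two] at h
  calc _ ≤ _ := pow_le_pow_left' h 2
    _ = _ := by
      rw [mul_pow, ← ENNReal.rpow_natCast, ← ENNReal.rpow_natCast, ← ENNReal.rpow_mul,
        ← ENNReal.rpow_mul]
      norm_num

/-- `P` is dominated by `Q` with likelihood ratio of squared `L²(Q)`-norm at most `K`. -/
def L2Dominated {α : Type*} [MeasurableSpace α] (P Q : Measure α) (K : ℝ≥0∞) : Prop :=
  ∀ g : α → ℝ≥0∞, Measurable g → (∫⁻ x, g x ∂P) ^ 2 ≤ K * ∫⁻ x, g x ^ 2 ∂Q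

theorem L2Dominated.sq_measure_le {α : Type*} [MeasurableSpace α] {P Q : Measure α} {K : ℝ≥0∞}
    (h : L2Dominated P Q K) {A : Set α} (hA : MeasurableSet A) : P A ^ 2 ≤ K * Q A := by
  have := h (A.indicator 1) (measurable_one.indicator hA)
  have h2 : (fun x => A.indicator (1 : α → ℝ≥0∞) x ^ 2) = A.indicator 1 := by
    ext x
    by_cases hx : x ∈ A <;> simp [hx]
  rwa [h2, lintegral_indicator_one hA, lintegral_indicator_one hA] at this

theorem L2Dominated.prod {α β : Type*} [MeasurableSpace α] [MeasurableSpace β]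
    {P Q : Measure α} {P' Q' : Measure β} [SFinite P] [SFinite Q] [SFinite P'] [SFinite Q']
    {K K' : ℝ≥0∞} (h : L2Dominated P Q K) (h' : L2Dominated P' Q' K') :
    L2Dominated (P.prod P') (Q.prod Q') (K * K') := by
  intro g hg
  rw [lintegral_prod _ hg.aemeasurable, lintegral_prod _ (hg.pow_const 2).aemeasurable, mul_assoc]
  refine (h _ hg.lintegral_prod_right').trans ?_
  gcongr
  rw [← lintegral_const_mul _ (hg.pow_const 2).lintegral_prod_right']
  exact lintegral_mono fun x => h' _ (hg.comp measurable_prodMk_left)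

theorem L2Dominated.of_measurePreserving {α β : Type*} [MeasurableSpace α] [MeasurableSpace β]
    {P Q : Measure α} {P' Q' : Measure β} {K : ℝ≥0∞} {φ : α → β} (h : L2Dominated P Q K)
    (hP : MeasurePreserving φ P P') (hQ : MeasurePreserving φ Q Q') : L2Dominated P' Q' K := by
  intro g hg
  rw [← hP.lintegral_comp hg, ← hQ.lintegral_comp (hg.pow_const 2)]
  exact h _ (hg.comp hP.measurable)

theorem L2Dominated.pi {α : Type*} [MeasurableSpace α] {P Q : Measure α} [SigmaFinite P]
    [SigmaFinite Q] {K : ℝ≥0∞} (h : L2Dominated P Q K) (n : ℕ) :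
    L2Dominated (Measure.pi fun _ : Fin n => P) (Measure.pi fun _ : Fin n => Q) (K ^ n) := by
  induction n with
  | zero =>
    intro g hg
    rw [Measure.pi_of_empty _ (x := isEmptyElim), Measure.pi_of_empty _ (x := isEmptyElim),
      lintegral_dirac' _ hg, lintegral_dirac' _ (hg.pow_const 2)]
    simp
  | succ n ih =>
    rw [pow_succ']
    exact (h.prod ih).of_measurePreserving
      (measurePreserving_piFinSuccAbove (fun _ => P) 0).symm
      (measurePreserving_piFinSuccAbove (fun _ => Q) 0).symm

theorem l2Dominated_gaussianReal (m : ℝ) {v : ℝ≥0} (hv : v ≠ 0) :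
    L2Dominated (gaussianReal m v) (gaussianReal 0 v) (ENNReal.ofReal (Real.exp (m ^ 2 / v))) := by
  intro g hg
  have hv' : (v : ℝ) ≠ 0 := NNReal.coe_ne_zero.2 hv
  set L : ℝ → ℝ≥0∞ := fun y => ENNReal.ofReal (Real.exp (m * y / v - m ^ 2 / (2 * v))) with hL
  have hLm : Measurable L := by fun_prop
  have hpdf : gaussianPDF m v = gaussianPDF 0 v * L := by
    ext y
    simp only [gaussianPDF, gaussianPDFReal, hL, Pi.mul_apply]
    rw [← ENNReal.ofReal_mul (by positivity), mul_assoc _ (Real.exp _), ← Real.exp_add]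
    congr 3
    field_simp
    ring
  have hLsq : ∫⁻ y, L y ^ 2 ∂(gaussianReal 0 v) = ENNReal.ofReal (Real.exp (m ^ 2 / v)) := by
    have h1 : ∀ y, L y ^ 2 =
        ENNReal.ofReal (Real.exp (-(m ^ 2 / v)) * Real.exp (2 * m / v * y)) := by
      intro y
      simp only [hL]
      rw [← ENNReal.ofReal_pow (Real.exp_pos _).le, ← Real.exp_nat_mul, ← Real.exp_add]
      congr 2
      push_cast
      field_simp
      ring
    have hmgf := congrFun (mgf_id_gaussianReal (μ := 0) (v := v)) (2 * m / v)
    simp only [mgf, id] at hmgf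
    simp_rw [h1]
    rw [← ofReal_integral_eq_lintegral_ofReal
      ((integrable_exp_mul_gaussianReal _).const_mul _) (ae_of_all _ fun y => by positivity),
      integral_const_mul, hmgf, ← Real.exp_add]
    congr 2
    field_simp
    ring
  have hchange : ∫⁻ y, g y ∂(gaussianReal m v) = ∫⁻ y, L y * g y ∂(gaussianReal 0 v) := by
    rw [gaussianReal_of_var_ne_zero _ hv, gaussianReal_of_var_ne_zero _ hv, hpdf,
      withDensity_mul _ (measurable_gaussianPDF _ _) hLm,
      lintegral_withDensity_eq_lintegral_mul _ hLm hg]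
    rfl
  rw [hchange, ← hLsq]
  exact sq_lintegral_mul_le _ hLm hg

theorem l2Dominated_pairLaw {μdens f : ℝ → ℝ} {σ : ℝ} (hσ : 0 < σ)
    [SFinite (designMeasure μdens)] (hf : Measurable f) :
    L2Dominated (pairLaw μdens σ f) (pairLaw μdens σ 0)
      (∫⁻ x, ENNReal.ofReal (Real.exp (f x ^ 2 / σ ^ 2)) ∂(designMeasure μdens)) := by
  intro g hg
  set v : ℝ≥0 := ⟨σ ^ 2, sq_nonneg σ⟩
  have hv : v ≠ 0 := by
    rw [← NNReal.coe_ne_zero]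
    exact pow_ne_zero 2 hσ.ne'
  have key : ∀ (u : ℝ → ℝ) (G : ℝ × ℝ → ℝ≥0∞), Measurable u → Measurable G →
      ∫⁻ z, G z ∂(pairLaw μdens σ u) =
        ∫⁻ x, ∫⁻ y, G (x, y) ∂(gaussianReal (u x) v) ∂(designMeasure μdens) := by
    intro u G hu hG
    have : IsProbabilityMeasure (gaussianReal 0 ⟨σ ^ 2, sq_nonneg σ⟩) :=
      instIsProbabilityMeasureGaussianReal _ _
    rw [pairLaw, lintegral_map hG (by fun_prop), lintegral_prod _ (by fun_prop)]
    refine lintegral_congr fun x => ?_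
    have h := gaussianReal_map_const_add (μ := 0) (v := v) (u x)
    rw [zero_add] at h
    rw [← h, lintegral_map (by fun_prop) (by fun_prop)]
  rw [key f g hf hg, key 0 _ measurable_zero (hg.pow_const 2)]
  set b : ℝ → ℝ≥0∞ := fun x => ∫⁻ y, g (x, y) ^ 2 ∂(gaussianReal 0 v)
  have hbm : Measurable b := (hg.pow_const 2).lintegral_prod_right'
  have hle : ∀ x, ∫⁻ y, g (x, y) ∂(gaussianReal (f x) v) ≤
      ENNReal.ofReal (Real.exp (f x ^ 2 / (2 * σ ^ 2))) * b x ^ (1 / 2 : ℝ) := by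
    intro x
    have h := l2Dominated_gaussianReal (f x) hv (fun y => g (x, y)) (by fun_prop)
    refine (ENNReal.pow_le_pow_left_iff two_ne_zero).1 (h.trans (le_of_eq ?_))
    rw [mul_pow, ← ENNReal.rpow_natCast (b x ^ (1 / 2 : ℝ)), ← ENNReal.rpow_mul,
      ← ENNReal.ofReal_pow (Real.exp_pos _).le, ← Real.exp_nat_mul]
    have : (v : ℝ) = σ ^ 2 := rfl
    rw [this]
    norm_num
    congr 3
    field_simp
  have hsq : ∀ x, ENNReal.ofReal (Real.exp (f x ^ 2 / (2 * σ ^ 2))) ^ 2 =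
      ENNReal.ofReal (Real.exp (f x ^ 2 / σ ^ 2)) := by
    intro x
    rw [← ENNReal.ofReal_pow (Real.exp_pos _).le, ← Real.exp_nat_mul]
    congr 2
    push_cast
    field_simp
  have hsq' : ∀ x, (b x ^ (1 / 2 : ℝ)) ^ 2 = b x := by
    intro x
    rw [← ENNReal.rpow_natCast, ← ENNReal.rpow_mul]
    norm_num
  calc _ ≤ _ := pow_le_pow_left' (lintegral_mono hle) 2
    _ ≤ _ := sq_lintegral_mul_le _ (by fun_prop) (hbm.pow_const _)
    _ = _ := by simp only [hsq, hsq']; rfl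

theorem le_max_lintegral_of_l2Dominated {α : Type*} [MeasurableSpace α] {P Q : Measure α}
    [IsProbabilityMeasure P] [IsProbabilityMeasure Q]
    (h : L2Dominated P Q (ENNReal.ofReal (Real.exp 2))) {p θ : ℝ} (hp : 0 < p) (hθ : 0 < θ)
    {T : α → ℝ} (hT : Measurable T) :
    ENNReal.ofReal ((θ / 2) ^ p * (Real.exp (-2) / 4)) ≤
      max (∫⁻ d, ENNReal.ofReal (|T d| ^ p) ∂Q) (∫⁻ d, ENNReal.ofReal (|T d - θ| ^ p) ∂P) := by
  set A : Set α := {d | θ / 2 ≤ |T d|}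
  have hA : MeasurableSet A := measurableSet_le measurable_const (by fun_prop)
  have hθp : 0 ≤ (θ / 2) ^ p := by positivity
  have hlow : ∀ (m : Measure α) (B : Set α), MeasurableSet B → ∀ (U : α → ℝ),
      (∀ d ∈ B, θ / 2 ≤ |U d|) →
      ENNReal.ofReal ((θ / 2) ^ p) * m B ≤ ∫⁻ d, ENNReal.ofReal (|U d| ^ p) ∂m := by
    intro m B hB U hU
    rw [← setLIntegral_const]
    refine (setLIntegral_mono' hB fun d hd => ?_).trans (setLIntegral_le_lintegral B _)
    exact ENNReal.ofReal_le_ofReal (Real.rpow_le_rpow (by positivity) (hU d hd) hp.le)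
  have hQ := hlow Q A hA T fun d hd => hd
  have hP := hlow P Aᶜ hA.compl (fun d => T d - θ) fun d hd => by
    have hd' : |T d| < θ / 2 := not_le.1 hd
    rw [abs_sub_comm]
    have := (abs_lt.1 hd').2
    exact le_abs.2 (Or.inl (by linarith))
  have hmain : Real.exp (-2) / 4 ≤ Q.real A ∨ Real.exp (-2) / 4 ≤ P.real Aᶜ := by
    by_contra! hcon
    have hsq : P.real A ^ 2 ≤ Real.exp 2 * Q.real A := by
      have := ENNReal.toReal_mono (ENNReal.mul_ne_top ENNReal.ofReal_ne_top (measure_ne_top Q A))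
        (h.sq_measure_le hA)
      rwa [ENNReal.toReal_pow, ENNReal.toReal_mul, ENNReal.toReal_ofReal (Real.exp_pos _).le]
        at this
    rw [probReal_compl_eq_one_sub hA] at hcon
    have he : Real.exp (-2) ≤ 1 := Real.exp_le_one_iff.2 (by norm_num)
    have hee : Real.exp 2 * Real.exp (-2) = 1 := by rw [← Real.exp_add]; norm_num
    have h1 : Real.exp 2 * Q.real A < 1 / 4 := by
      have := mul_lt_mul_of_pos_left hcon.1 (Real.exp_pos 2)
      linarith
    nlinarith
  rw [ENNReal.ofReal_mul hθp]
  rcases hmain with hm | hm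
  · refine le_max_of_le_left (le_trans ?_ hQ)
    gcongr
    exact (ENNReal.ofReal_le_iff_le_toReal (measure_ne_top _ _)).2 hm
  · refine le_max_of_le_right (le_trans ?_ hP)
    gcongr
    exact (ENNReal.ofReal_le_iff_le_toReal (measure_ne_top _ _)).2 hm

theorem isProbabilityMeasure_pairLaw {μdens f : ℝ → ℝ} (σ : ℝ)
    [IsProbabilityMeasure (designMeasure μdens)] (hf : Measurable f) :
    IsProbabilityMeasure (pairLaw μdens σ f) := by
  have : IsProbabilityMeasure (gaussianReal 0 ⟨σ ^ 2, sq_nonneg σ⟩) :=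
    instIsProbabilityMeasureGaussianReal _ _
  exact Measure.isProbabilityMeasure_map (by fun_prop)

theorem isProbabilityMeasure_jointLaw {μdens f : ℝ → ℝ} (σ : ℝ) (n : ℕ)
    [IsProbabilityMeasure (designMeasure μdens)] (hf : Measurable f) :
    IsProbabilityMeasure (jointLaw μdens σ f n) := by
  have := isProbabilityMeasure_pairLaw (μdens := μdens) σ hf
  unfold jointLaw
  infer_instance

/-- Two-point lower bound for the minimax risk, for two hypotheses whose joint laws are
`L²`-close. -/
theorem le_minimaxRiskE {μdens f : ℝ → ℝ} {σ x₀ p : ℝ} {n : ℕ} {F : Set (ℝ → ℝ)} (hσ : 0 < σ)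
    (hp : 0 < p) [IsProbabilityMeasure (designMeasure μdens)] (hf : Measurable f)
    (hf₀ : 0 < f x₀) (h0F : 0 ∈ F) (hfF : f ∈ F)
    (hchi : (∫⁻ x, ENNReal.ofReal (Real.exp (f x ^ 2 / σ ^ 2)) ∂(designMeasure μdens)) ^ n ≤
      ENNReal.ofReal (Real.exp 2)) :
    ENNReal.ofReal (f x₀ / 2 * (Real.exp (-2) / 4) ^ (1 / p)) ≤ minimaxRiskE μdens σ n F x₀ p := by
  have h0 : Measurable (0 : ℝ → ℝ) := measurable_zero
  have hP := isProbabilityMeasure_jointLaw (μdens := μdens) σ n hf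
  have hQ := isProbabilityMeasure_jointLaw (μdens := μdens) σ n h0
  have hPp := isProbabilityMeasure_pairLaw (μdens := μdens) σ hf
  have hQp := isProbabilityMeasure_pairLaw (μdens := μdens) σ h0
  have hdom : L2Dominated (jointLaw μdens σ f n) (jointLaw μdens σ 0 n)
      (ENNReal.ofReal (Real.exp 2)) := fun g hg =>
    ((l2Dominated_pairLaw hσ hf).pi n g hg).trans (mul_le_mul' hchi le_rfl)
  have hroot : ENNReal.ofReal (f x₀ / 2 * (Real.exp (-2) / 4) ^ (1 / p)) =
      ENNReal.ofReal ((f x₀ / 2) ^ p * (Real.exp (-2) / 4)) ^ (1 / p) := by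
    rw [ENNReal.ofReal_rpow_of_pos (by positivity), Real.mul_rpow (by positivity) (by positivity),
      ← Real.rpow_mul (by positivity), mul_one_div_cancel hp.ne', Real.rpow_one]
  rw [hroot, minimaxRiskE]
  gcongr
  refine le_iInf fun T => (le_max_lintegral_of_l2Dominated hdom hp hf₀ T.2).trans (max_le ?_ ?_)
  · refine le_iSup₂_of_le 0 h0F ?_
    simp
  · exact le_iSup₂_of_le f hfF le_rfl

theorem AssumptionM.exists_radius {μdens ν : ℝ → ℝ} {x₀ : ℝ}
    [IsProbabilityMeasure (designMeasure μdens)] (hM : AssumptionM μdens ν x₀) :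
    ∃ ε > 0, IntegrableOn ν (Ioc 0 ε) ∧ ∀ h, 0 < h → h ≤ ε →
      designMeasure μdens (Metric.closedBall x₀ h) ≤ ENNReal.ofReal (2 * Fnu ν h) := by
  obtain ⟨hc, hpos, W, hW, hμ⟩ := hM
  obtain ⟨ε, hε, hball⟩ := Metric.nhds_basis_closedBall.mem_iff.1 hW
  have hden : ∀ B : Set ℝ, MeasurableSet B →
      designMeasure μdens B = ∫⁻ x in B, ENNReal.ofReal (μdens x) := fun B hB =>
    withDensity_apply _ hB
  set S : ℝ → Set ℝ := fun h => (fun x => x - x₀) ⁻¹' Ioc 0 h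
  set S' : ℝ → Set ℝ := fun h => (fun x => x₀ - x) ⁻¹' Ioc 0 h
  have hSm : ∀ h, MeasurableSet (S h) := fun h =>
    measurableSet_Ioc.preimage (by fun_prop)
  have hSm' : ∀ h, MeasurableSet (S' h) := fun h =>
    measurableSet_Ioc.preimage (by fun_prop)
  have hS : ∀ h ≤ ε, designMeasure μdens (S h) = ∫⁻ t in Ioc 0 h, ENNReal.ofReal (ν t) := by
    intro h hh
    rw [hden _ (hSm h), ← (measurePreserving_sub_right volume x₀).setLIntegral_comp_preimage_emb
      (MeasurableEquiv.subRight x₀).measurableEmbedding (fun t => ENNReal.ofReal (ν t))]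
    refine setLIntegral_congr_fun (hSm h) fun x hx => ?_
    have hx0 : |x - x₀| = x - x₀ := abs_of_pos hx.1
    rw [hμ x (hball (by rw [Metric.mem_closedBall, Real.dist_eq, hx0]; exact hx.2.trans hh)), hx0]
  have hS' : ∀ h ≤ ε, designMeasure μdens (S' h) = ∫⁻ t in Ioc 0 h, ENNReal.ofReal (ν t) := by
    intro h hh
    rw [hden _ (hSm' h), ← (Measure.measurePreserving_sub_left volume x₀).setLIntegral_comp_preimage_emb
      (MeasurableEquiv.subLeft x₀).measurableEmbedding (fun t => ENNReal.ofReal (ν t))]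
    refine setLIntegral_congr_fun (hSm' h) fun x hx => ?_
    have hx0 : |x - x₀| = x₀ - x := by rw [abs_sub_comm]; exact abs_of_pos hx.1
    rw [hμ x (hball (by rw [Metric.mem_closedBall, Real.dist_eq, hx0]; exact hx.2.trans hh)), hx0]
  have hint : IntegrableOn ν (Ioc 0 ε) := by
    refine ⟨(hc.mono fun t ht => ht.1).aestronglyMeasurable measurableSet_Ioc, ?_⟩
    rw [hasFiniteIntegral_iff_ofReal ((ae_restrict_iff' measurableSet_Ioc).2
      (ae_of_all _ fun t ht => (hpos t ht.1).le)), ← hS ε le_rfl]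
    exact measure_lt_top _ _
  refine ⟨ε, hε, hint, fun h h0 hh => ?_⟩
  have hF : ∫⁻ t in Ioc 0 h, ENNReal.ofReal (ν t) = ENNReal.ofReal (Fnu ν h) := by
    rw [Fnu, intervalIntegral.integral_of_le h0.le, ofReal_integral_eq_lintegral_ofReal]
    · exact hint.mono_set (Ioc_subset_Ioc_right hh)
    · exact (ae_restrict_iff' measurableSet_Ioc).2 (ae_of_all _ fun t ht => (hpos t ht.1).le)
  have hsub : Metric.closedBall x₀ h ⊆ {x₀} ∪ (S h ∪ S' h) := by
    intro x hx
    rw [Metric.mem_closedBall, Real.dist_eq] at hx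
    rcases lt_trichotomy x x₀ with hlt | rfl | hlt
    · exact Or.inr (Or.inr ⟨sub_pos.2 hlt, by
        rw [abs_sub_comm] at hx; exact (le_abs_self _).trans hx⟩)
    · exact Or.inl rfl
    · exact Or.inr (Or.inl ⟨sub_pos.2 hlt, (le_abs_self _).trans hx⟩)
  have hnull : designMeasure μdens {x₀} = 0 :=
    withDensity_absolutelyContinuous _ _ (measure_singleton x₀)
  calc designMeasure μdens (Metric.closedBall x₀ h)
      ≤ designMeasure μdens {x₀} + (designMeasure μdens (S h) + designMeasure μdens (S' h)) :=
        (measure_mono hsub).trans ((measure_union_le _ _).trans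
          (add_le_add le_rfl (measure_union_le _ _)))
    _ = ENNReal.ofReal (2 * Fnu ν h) := by
        rw [hnull, hS h hh, hS' h hh, hF, zero_add, ← two_mul, ENNReal.ofReal_mul two_pos.le]
        norm_num

theorem tendsto_bandwidth_zero_s7 {ω ν : ℝ → ℝ} {s σ ε : ℝ} {h : ℕ → ℝ} (hs : 0 < s) (hσ : 0 < σ)
    (hω : RegVaryAt0 ω s) (hε : 0 < ε) (hint : IntegrableOn ν (Ioc 0 ε))
    (hνpos : ∀ t, 0 < t → 0 < ν t) (hh : ∀ n : ℕ, 0 < n → IsSmallestBandwidth ν ω σ n (h n)) :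
    Tendsto h atTop (nhdsWithin 0 (Ioi 0)) := by
  have hFc : ContinuousOn (Fnu ν) (Icc 0 ε) :=
    intervalIntegral.continuousOn_primitive_interval' (by
      rw [intervalIntegrable_iff_integrableOn_Ioc_of_le hε.le]; exact hint) (by simp [hε.le])
      |>.mono (by rw [uIcc_of_le hε.le])
  have hFpos : ∀ t, 0 < t → t ≤ ε → 0 < Fnu ν t := fun t ht hte =>
    intervalIntegral.intervalIntegral_pos_of_pos_on
      ((intervalIntegrable_iff_integrableOn_Ioc_of_le ht.le).2
        (hint.mono_set (Ioc_subset_Ioc_right hte))) (fun x hx => hνpos x hx.1) ht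
  have hωlim := hω.tendsto_zero hs
  obtain ⟨hωpos, hωc, -⟩ := hω
  have hev : ∀ δ, 0 < δ → ∀ᶠ n in atTop, h n ≤ δ := by
    intro δ' hδ'
    set δ := min δ' ε
    have hδ : 0 < δ := lt_min hδ' hε
    have hδε : δ ≤ ε := min_le_right _ _
    have hbig : Tendsto (fun n : ℕ => ω δ * Real.sqrt (2 * n * Fnu ν δ)) atTop atTop := by
      refine Tendsto.const_mul_atTop (hωpos δ hδ) (Real.tendsto_sqrt_atTop.comp ?_)
      exact (tendsto_natCast_atTop_atTop.const_mul_atTop two_pos).atTop_mul_const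
        (hFpos δ hδ hδε)
    filter_upwards [hbig.eventually_ge_atTop σ, eventually_gt_atTop 0] with n hn hn0
    set Φ : ℝ → ℝ := fun t => ω t * Real.sqrt (2 * n * Fnu ν t)
    have hF0 : Tendsto (Fnu ν) (nhdsWithin 0 (Ioi 0)) (nhds (Fnu ν 0)) :=
      ((hFc 0 ⟨le_rfl, hε.le⟩).mono_of_mem_nhdsWithin
        (Icc_mem_nhdsGT hε)).tendsto
    have hΦ0 : Tendsto Φ (nhdsWithin 0 (Ioi 0)) (nhds 0) := by
      have := hωlim.mul ((hF0.const_mul (2 * (n : ℝ))).sqrt)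
      rwa [zero_mul] at this
    obtain ⟨t, htσ, ht⟩ := ((hΦ0.eventually (gt_mem_nhds hσ)).and
      (Ioc_mem_nhdsGT hδ)).exists
    have hΦc : ContinuousOn Φ (Icc t δ) := by
      refine (hωc.mono fun x hx => ht.1.trans_le hx.1).mul (Real.continuous_sqrt.comp_continuousOn
        (continuousOn_const.mul (hFc.mono fun x hx => ⟨ht.1.le.trans hx.1, hx.2.trans hδε⟩)))
    obtain ⟨u, hu, hΦu⟩ := intermediate_value_Icc ht.2 hΦc ⟨htσ.le, hn⟩
    exact ((hh n hn0).2.2 u (ht.1.trans_le hu.1) hΦu).trans (hu.2.trans (min_le_left _ _))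
  have hpos : ∀ᶠ n in atTop, 0 < h n := (eventually_gt_atTop 0).mono fun n hn => (hh n hn).1
  refine tendsto_nhdsWithin_iff.2 ⟨?_, hpos⟩
  refine tendsto_order.2 ⟨fun a ha => hpos.mono fun n hn => ha.trans hn, fun a ha => ?_⟩
  exact (hev (a / 2) (half_pos ha)).mono fun n hn => by linarith

theorem indicator_const_mem_sigmaClass {x₀ θ δ α : ℝ} {ω : ℝ → ℝ} (k : ℕ)
    (hω : ∀ h, 0 < h → 0 < ω h) (hθ : 0 ≤ θ) (hθα : θ ≤ α) :
    (Metric.closedBall x₀ δ).indicator (fun _ => θ) ∈ sigmaClass x₀ ω k δ α := by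
  constructor
  · intro h h0 hδ ε hε
    refine ⟨Polynomial.C θ, by simp, fun x _ hx => ?_⟩
    rw [indicator_of_mem (by
      rw [Metric.mem_closedBall, Real.dist_eq]; exact hx.trans hδ), Polynomial.eval_C, sub_self,
      abs_zero]
    exact (add_pos (hω h h0) hε).le
  · intro x _
    by_cases hx : x ∈ Metric.closedBall x₀ δ
    · rwa [indicator_of_mem hx, abs_of_nonneg hθ]
    · rw [indicator_of_notMem hx, abs_zero]
      exact hθ.trans hθα

theorem zero_mem_sigmaClass {x₀ δ α : ℝ} {ω : ℝ → ℝ} (k : ℕ) (hω : ∀ h, 0 < h → 0 < ω h)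
    (hα : 0 ≤ α) : 0 ∈ sigmaClass x₀ ω k δ α := by
  have := indicator_const_mem_sigmaClass (x₀ := x₀) (δ := δ) k hω le_rfl hα
  rwa [indicator_zero] at this

theorem lintegral_exp_sq_indicator_pow_le {μdens : ℝ → ℝ} {σ θ F : ℝ} {n : ℕ} {B : Set ℝ}
    [IsProbabilityMeasure (designMeasure μdens)] (hB : MeasurableSet B) (hσ : 0 < σ) (hF : 0 < F)
    (hn : 0 < n) (hBF : designMeasure μdens B ≤ ENNReal.ofReal (2 * F))
    (hθ : θ ^ 2 * (2 * n * F) = σ ^ 2) (hnF : 1 ≤ 2 * n * F) :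
    (∫⁻ x, ENNReal.ofReal (Real.exp (B.indicator (fun _ => θ) x ^ 2 / σ ^ 2))
      ∂(designMeasure μdens)) ^ n ≤ ENNReal.ofReal (Real.exp 2) := by
  set a := θ ^ 2 / σ ^ 2 with ha
  have hn' : (0 : ℝ) < n := Nat.cast_pos.2 hn
  have haF : a * (2 * n * F) = 1 := by
    rw [ha, div_mul_eq_mul_div, hθ, div_self (by positivity)]
  have ha0 : 0 ≤ a := by positivity
  have ha1 : a ≤ 1 := haF ▸ le_mul_of_one_le_right ha0 hnF
  have hexp : Real.exp a - 1 ≤ 2 * a := by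
    have := Real.abs_exp_sub_one_le (x := a) (by rwa [abs_of_nonneg ha0])
    rw [abs_of_nonneg ha0] at this
    exact (le_abs_self _).trans this
  have hpt : ∀ x, ENNReal.ofReal (Real.exp (B.indicator (fun _ => θ) x ^ 2 / σ ^ 2)) ≤
      1 + B.indicator (fun _ => ENNReal.ofReal (2 * a)) x := by
    intro x
    by_cases hx : x ∈ B
    · rw [indicator_of_mem hx, indicator_of_mem hx, ← ENNReal.ofReal_one,
        ← ENNReal.ofReal_add one_pos.le (by positivity)]
      exact ENNReal.ofReal_le_ofReal (by linarith)
    · simp [indicator_of_notMem hx]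
  have hle : ∫⁻ x, ENNReal.ofReal (Real.exp (B.indicator (fun _ => θ) x ^ 2 / σ ^ 2))
      ∂(designMeasure μdens) ≤ ENNReal.ofReal (Real.exp (2 / n)) := by
    refine (lintegral_mono hpt).trans ?_
    rw [lintegral_add_left measurable_const, lintegral_const, measure_univ,
      lintegral_indicator_const hB]
    calc 1 * 1 + ENNReal.ofReal (2 * a) * designMeasure μdens B
        ≤ ENNReal.ofReal 1 + ENNReal.ofReal (2 * a) * ENNReal.ofReal (2 * F) := by
          rw [ENNReal.ofReal_one, mul_one]; gcongr
      _ = ENNReal.ofReal (1 + 2 * a * (2 * F)) := by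
          rw [← ENNReal.ofReal_mul (by positivity), ENNReal.ofReal_add one_pos.le (by positivity)]
      _ ≤ ENNReal.ofReal (Real.exp (2 / n)) := by
          refine ENNReal.ofReal_le_ofReal ?_
          have : 2 * a * (2 * F) = 2 / n := by
            rw [eq_div_iff hn'.ne']; linear_combination 2 * haF
          rw [this, add_comm]
          exact Real.add_one_le_exp _
  refine (pow_le_pow_left' hle n).trans (le_of_eq ?_)
  rw [← ENNReal.ofReal_pow (Real.exp_pos _).le, ← Real.exp_nat_mul, mul_div_cancel₀ _ hn'.ne']

/-- Proposition 6: minimax lower bound `liminf r_n⁻¹ R_n(Σ, μ) ≥ C_{s,p}`. -/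
theorem statement7 (s p : ℝ) (hs : 0 < s) (hp : 0 < p) :
    ∃ C > (0:ℝ),
      ∀ (σ x₀ : ℝ), 0 < σ →
      ∀ (ω ν μdens : ℝ → ℝ),
        RegVaryAt0 ω s →
        Measurable μdens → (∀ x, 0 ≤ μdens x) →
        IsProbabilityMeasure (designMeasure μdens) →
        AssumptionM μdens ν x₀ →
      ∀ (hseq αseq : ℕ → ℝ),
        (∀ n : ℕ, 0 < n → IsSmallestBandwidth ν ω σ n (hseq n)) →
        (∀ n, 0 < αseq n) → Filter.Tendsto αseq atTop atTop →
        ENNReal.ofReal C ≤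
          Filter.liminf (fun n : ℕ =>
              minimaxRiskE μdens σ n (sigmaClass x₀ ω (kdeg s) (hseq n) (αseq n)) x₀ p /
                ENNReal.ofReal (ω (hseq n)))
            atTop := by
  set δ : ℝ := (Real.exp (-2) / 4) ^ (1 / p)
  have hδ0 : 0 < δ := by positivity
  refine ⟨δ / 2, by positivity, ?_⟩
  intro σ x₀ hσ ω ν μdens hω _ _ hprob hM hseq αseq hband hαpos hα
  obtain ⟨ε, hε, hint, hball⟩ := hM.exists_radius
  have hνpos := hM.2.1
  have hlim := tendsto_bandwidth_zero_s7 hs hσ hω hε hint hνpos hband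
  have hωlim := (hω.tendsto_zero hs).comp hlim
  have hhε : ∀ᶠ n in atTop, hseq n ∈ Ioc 0 ε := hlim.eventually (Ioc_mem_nhdsGT hε)
  refine le_liminf_of_le (by isBoundedDefault) ?_
  filter_upwards [hhε, hωlim.eventually (ge_mem_nhds hσ), hωlim.eventually (ge_mem_nhds one_pos),
    hα.eventually_ge_atTop 1, eventually_gt_atTop 0] with n hn hωσ hω1 hα1 hn0
  simp only [Function.comp] at hωσ hω1
  set θ := ω (hseq n)
  have hθ0 : 0 < θ := hω.1 _ hn.1
  have hn' : (0 : ℝ) < n := Nat.cast_pos.2 hn0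
  have hF : 0 < Fnu ν (hseq n) := by
    by_contra! hcon
    have h := (hband n hn0).2.1
    rw [Real.sqrt_eq_zero_of_nonpos (mul_nonpos_of_nonneg_of_nonpos (by positivity) hcon),
      mul_zero] at h
    exact hσ.ne h
  have hsq : θ ^ 2 * (2 * n * Fnu ν (hseq n)) = σ ^ 2 := by
    rw [← (hband n hn0).2.1, mul_pow, Real.sq_sqrt (by positivity)]
  have hnF : 1 ≤ 2 * n * Fnu ν (hseq n) := by
    have h1 : θ ^ 2 ≤ σ ^ 2 := pow_le_pow_left₀ hθ0.le hωσ 2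
    rw [← hsq] at h1
    exact le_of_mul_le_mul_left (by rwa [mul_one]) (pow_pos hθ0 2)
  have hx₀ : x₀ ∈ Metric.closedBall x₀ (hseq n) := Metric.mem_closedBall_self hn.1.le
  have hval : (Metric.closedBall x₀ (hseq n)).indicator (fun _ => θ) x₀ = θ :=
    indicator_of_mem hx₀ _
  have hrisk := le_minimaxRiskE (μdens := μdens) (x₀ := x₀)
    (f := (Metric.closedBall x₀ (hseq n)).indicator fun _ => θ) hσ hp
    (measurable_const.indicator Metric.isClosed_closedBall.measurableSet) (by rwa [hval])
    (zero_mem_sigmaClass (kdeg s) hω.1 (hαpos n).le)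
    (indicator_const_mem_sigmaClass (kdeg s) hω.1 hθ0.le (hω1.trans hα1))
    (lintegral_exp_sq_indicator_pow_le Metric.isClosed_closedBall.measurableSet hσ hF hn0
      (hball _ hn.1 hn.2) hsq hnF)
  rw [hval] at hrisk
  rw [ENNReal.le_div_iff_mul_le (Or.inl (ENNReal.ofReal_pos.2 hθ0).ne')
    (Or.inl ENNReal.ofReal_ne_top), ← ENNReal.ofReal_mul (by positivity)]
  refine le_trans (le_of_eq ?_) hrisk
  congr 1
  ring

end
end

section
/- Let γ > 0 and α ∈ ℝ, and let G(h) = h^γ (log(1/h))^α for h ∈ (0,1). Then the generalized inverse G^←(x) = inf{y > 0 : G(y) ≥ x} satisfies G^←(x) ∼ γ^{α/γ} x^{1/γ} (log(1/x))^{−α/γ} as x → 0⁺. -/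
open MeasureTheory ProbabilityTheory Filter Set Matrix Asymptotics
open scoped ENNReal NNReal

noncomputable section

/-- `t ↦ α log t - γ t` is antitone on `[1 + |α| / γ, ∞)`. -/
lemma mul_log_sub_mul_le {γ α s t : ℝ} (hγ : 0 < γ) (hs : 1 + |α| / γ ≤ s) (hst : s ≤ t) :
    α * Real.log t - γ * t ≤ α * Real.log s - γ * s := by
  have hq : 0 ≤ |α| / γ := by positivity
  have hs0 : 0 < s := by linarith
  have ht0 : 0 < t := by linarith
  have hlog0 : 0 ≤ Real.log t - Real.log s := sub_nonneg.2 (Real.log_le_log hs0 hst)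
  have hlog : Real.log t - Real.log s ≤ (t - s) / s := by
    rw [← Real.log_div ht0.ne' hs0.ne', sub_div, div_self hs0.ne']
    exact Real.log_le_sub_one_of_pos (by positivity)
  have hα : |α| ≤ γ * s := by
    have : |α| / γ ≤ s := by linarith
    rwa [div_le_iff₀ hγ, mul_comm] at this
  have hmul : |α| * ((t - s) / s) ≤ γ * (t - s) := by
    rw [← mul_div_assoc, div_le_iff₀ hs0]
    nlinarith [mul_le_mul_of_nonneg_right hα (sub_nonneg.2 hst)]
  have h1 : α * (Real.log t - Real.log s) ≤ |α| * (Real.log t - Real.log s) :=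
    mul_le_mul_of_nonneg_right (le_abs_self α) hlog0
  have h2 := mul_le_mul_of_nonneg_left hlog (abs_nonneg α)
  linarith

lemma tendsto_div_add_mul_log_sub_div (γ b k : ℝ) :
    Tendsto (fun L : ℝ => (L / γ + b * Real.log L - k) / L) atTop (nhds (1 / γ)) := by
  have hlog : Tendsto (fun L : ℝ => Real.log L / L) atTop (nhds 0) :=
    Real.isLittleO_log_id_atTop.tendsto_div_nhds_zero
  have hk : Tendsto (fun L : ℝ => k / L) atTop (nhds 0) := tendsto_const_nhds.div_atTop tendsto_id
  have h := ((hlog.const_mul b).const_add (1 / γ)).sub hk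
  simp only [mul_zero, add_zero, sub_zero] at h
  refine h.congr' ?_
  filter_upwards [eventually_gt_atTop 0] with L hL
  field_simp

lemma tendsto_div_add_mul_log_sub_atTop {γ : ℝ} (hγ : 0 < γ) (b k : ℝ) :
    Tendsto (fun L : ℝ => L / γ + b * Real.log L - k) atTop atTop := by
  refine ((tendsto_div_add_mul_log_sub_div γ b k).pos_mul_atTop (by positivity)
    tendsto_id).congr' ?_
  filter_upwards [eventually_gt_atTop 0] with L hL
  simp only [id]
  field_simp

lemma tendsto_mul_log_sub_mul_add {γ : ℝ} (hγ : 0 < γ) (α l : ℝ) :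
    Tendsto (fun L : ℝ =>
      α * Real.log (L / γ + α / γ * Real.log L - (α / γ * Real.log γ + l)) -
        γ * (L / γ + α / γ * Real.log L - (α / γ * Real.log γ + l)) + L)
      atTop (nhds (γ * l)) := by
  set k := α / γ * Real.log γ + l with hk
  have h := ((((tendsto_div_add_mul_log_sub_div γ (α / γ) k).log
    (by positivity)).const_mul α).add_const (γ * k))
  have hlim : α * Real.log (1 / γ) + γ * k = γ * l := by
    rw [hk, one_div, Real.log_inv]
    field_simp
    ring
  rw [hlim] at h
  refine h.congr' ?_
  filter_upwards [eventually_gt_atTop 0,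
    (tendsto_div_add_mul_log_sub_atTop hγ (α / γ) k).eventually_gt_atTop 0] with L hL hM
  rw [Real.log_div hM.ne' hL.ne']
  field_simp
  ring

lemma le_rpow_mul_log_rpow_iff {γ α x y : ℝ} (hx : 0 < x) (hy : 0 < y) (hy1 : y < 1) :
    x ≤ y ^ γ * Real.log (1 / y) ^ α ↔
      Real.log x ≤ α * Real.log (-Real.log y) - γ * -Real.log y := by
  have hl : 0 < -Real.log y := neg_pos.2 (Real.log_neg hy hy1)
  rw [one_div, Real.log_inv, ← Real.log_le_log_iff hx (by positivity),
    Real.log_mul (by positivity) (by positivity), Real.log_rpow hy, Real.log_rpow hl]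
  constructor <;> intro h <;> linarith

/-- Proposition 7: asymptotics of the generalized inverse of
`G(h) = h^γ (log(1/h))^α` at `0⁺`. -/
theorem statement8 (γ α : ℝ) (hγ : 0 < γ) :
    Filter.Tendsto (fun x : ℝ =>
        sInf {y : ℝ | 0 < y ∧ y < 1 ∧ x ≤ y ^ γ * Real.log (1 / y) ^ α} /
          (γ ^ (α / γ) * x ^ (1 / γ) * Real.log (1 / x) ^ (-(α / γ))))
      (nhdsWithin (0:ℝ) (Set.Ioi 0)) (nhds 1) := by
  set D : ℝ → ℝ := fun x => γ ^ (α / γ) * x ^ (1 / γ) * Real.log (1 / x) ^ (-(α / γ)) with hD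
  have hL : Tendsto (fun x : ℝ => -Real.log x) (nhdsWithin (0:ℝ) (Set.Ioi 0)) atTop :=
    tendsto_neg_atBot_atTop.comp Real.tendsto_log_nhdsGT_zero
  have hx0 : ∀ᶠ x : ℝ in nhdsWithin (0:ℝ) (Set.Ioi 0), 0 < x := self_mem_nhdsWithin
  have hDpos : ∀ᶠ x in nhdsWithin (0:ℝ) (Set.Ioi 0), 0 < D x := by
    filter_upwards [hx0, hL.eventually_gt_atTop 0] with x hx hl
    simp only [hD, one_div, Real.log_inv]
    positivity
  have hlogD : ∀ c : ℝ, 0 < c → ∀ᶠ x in nhdsWithin (0:ℝ) (Set.Ioi 0),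
      -Real.log (c * D x) = -Real.log x / γ + α / γ * Real.log (-Real.log x) -
        (α / γ * Real.log γ + Real.log c) := by
    intro c hc
    filter_upwards [hx0, hL.eventually_gt_atTop 0, hDpos] with x hx hl hd
    rw [Real.log_mul hc.ne' hd.ne']
    simp only [hD, one_div, Real.log_inv]
    rw [Real.log_mul (by positivity) (by positivity), Real.log_mul (by positivity) (by positivity),
      Real.log_rpow hγ, Real.log_rpow hx, Real.log_rpow hl]
    ring
  have hM : ∀ c : ℝ, 0 < c →
      Tendsto (fun x => -Real.log (c * D x)) (nhdsWithin (0:ℝ) (Set.Ioi 0)) atTop := fun c hc =>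
    ((tendsto_div_add_mul_log_sub_atTop hγ (α / γ) (α / γ * Real.log γ + Real.log c)).comp
      hL).congr' ((hlogD c hc).mono fun x h => h.symm)
  have hG : ∀ c : ℝ, 0 < c →
      Tendsto (fun x => α * Real.log (-Real.log (c * D x)) - γ * -Real.log (c * D x) - Real.log x)
        (nhdsWithin (0:ℝ) (Set.Ioi 0)) (nhds (γ * Real.log c)) := fun c hc =>
    ((tendsto_mul_log_sub_mul_add hγ α (Real.log c)).comp hL).congr'
      ((hlogD c hc).mono fun x h => by simp only [Function.comp, h]; ring)
  have hmem : ∀ c : ℝ, 1 < c → ∀ᶠ x in nhdsWithin (0:ℝ) (Set.Ioi 0),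
      c * D x ∈ {y : ℝ | 0 < y ∧ y < 1 ∧ x ≤ y ^ γ * Real.log (1 / y) ^ α} := by
    intro c hc
    have hc0 : 0 < c := by linarith
    filter_upwards [hx0, hDpos, (hM c hc0).eventually_gt_atTop 0,
      (hG c hc0).eventually_const_lt (mul_pos hγ (Real.log_pos hc))] with x hx hd hm hg
    have hcd : 0 < c * D x := mul_pos hc0 hd
    have hcd1 : c * D x < 1 := (Real.log_neg_iff hcd).1 (by linarith)
    exact ⟨hcd, hcd1, (le_rpow_mul_log_rpow_iff hx hcd hcd1).2 (by linarith)⟩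
  refine tendsto_order.2 ⟨fun a ha => ?_, fun a ha => ?_⟩
  · obtain ⟨c, hac, hc1⟩ := exists_between (max_lt ha one_pos)
    have hc0 : 0 < c := (le_max_right _ _).trans_lt hac
    filter_upwards [hx0, hDpos, hmem 2 one_lt_two, (hM c hc0).eventually_ge_atTop (1 + |α| / γ),
      (hG c hc0).eventually_lt_const (mul_neg_of_pos_of_neg hγ (Real.log_neg hc0 hc1))]
      with x hx hd hne hm hg
    refine ((le_max_left _ _).trans_lt hac).trans_le ((le_div_iff₀ hd).2 (le_csInf ⟨_, hne⟩ ?_))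
    rintro y ⟨hy, hy1, hxy⟩
    by_contra! hlt
    rw [le_rpow_mul_log_rpow_iff hx hy hy1] at hxy
    linarith [mul_log_sub_mul_le hγ hm (neg_le_neg (Real.log_le_log hy hlt.le))]
  · obtain ⟨c, hc1, hca⟩ := exists_between ha
    filter_upwards [hDpos, hmem c hc1] with x hd hx
    exact ((div_le_iff₀ hd).2 (csInf_le ⟨0, fun y hy => hy.1.le⟩ hx)).trans_lt hca

end
end

section
/- Let α > 0, γ > 0 and c > 0. For n large enough the equation h^γ exp(−1/h^α) = c/n has a smallest positive solution h_n, and h_n ∼ (log n)^{−1/α} as n → ∞. -/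
open MeasureTheory ProbabilityTheory Filter Set Matrix Asymptotics
open scoped ENNReal NNReal

noncomputable section

/-- The function `u ↦ u + k log u` takes every value `y ≥ 1` at some point `u ≥ 1`. -/
lemma exists_add_mul_log_eq {k y : ℝ} (hk : 0 ≤ k) (hy : 1 ≤ y) :
    ∃ u : ℝ, 1 ≤ u ∧ u + k * Real.log u = y := by
  have hcont : ContinuousOn (fun u : ℝ => u + k * Real.log u) (Set.Icc 1 y) := by
    refine continuousOn_id.add (continuousOn_const.mul (Real.continuousOn_log.mono ?_))
    intro x hx
    have := hx.1
    simp only [Set.mem_compl_iff, Set.mem_singleton_iff]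
    linarith
  have hmem : y ∈ Set.Icc (1 + k * Real.log 1) (y + k * Real.log y) := by
    refine ⟨by simpa using hy, ?_⟩
    have := mul_nonneg hk (Real.log_nonneg hy)
    linarith
  obtain ⟨u, hu, hueq⟩ := intermediate_value_Icc hy hcont hmem
  exact ⟨u, hu.1, hueq⟩

/-- If `u + k log u = y` with `u ≥ 1` for large `y`, then `u ∼ y`. -/
lemma tendsto_div_of_add_mul_log_eq {k : ℝ} (hk : 0 ≤ k) {U : ℝ → ℝ}
    (hU : ∀ y, 1 ≤ y → 1 ≤ U y ∧ U y + k * Real.log (U y) = y) :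
    Tendsto (fun y => U y / y) atTop (nhds 1) := by
  have hbound : ∀ᶠ y in atTop, y / (1 + k) ≤ U y := by
    filter_upwards [eventually_ge_atTop 1] with y hy
    obtain ⟨h1, h2⟩ := hU y hy
    rw [div_le_iff₀ (by linarith)]
    nlinarith [mul_le_mul_of_nonneg_left (Real.log_le_self (zero_le_one.trans h1)) hk]
  have hUtop : Tendsto U atTop atTop :=
    tendsto_atTop_mono' _ hbound (tendsto_id.atTop_div_const (by linarith))
  have hlog : Tendsto (fun y => Real.log (U y) / U y) atTop (nhds 0) :=
    Real.isLittleO_log_id_atTop.tendsto_div_nhds_zero.comp hUtop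
  have hinv : Tendsto (fun y => (1 + k * (Real.log (U y) / U y))⁻¹) atTop (nhds 1) := by
    simpa using ((hlog.const_mul k).const_add 1).inv₀ (by simp)
  refine hinv.congr' ?_
  filter_upwards [eventually_ge_atTop 1] with y hy
  obtain ⟨h1, h2⟩ := hU y hy
  have hpos : 0 < U y := by linarith
  have : 1 + k * (Real.log (U y) / U y) = y / U y := by
    field_simp
    linarith
  rw [this, inv_div]

/-- The function `h ↦ h ^ γ * exp (-1 / h ^ α)` is strictly increasing on `(0, ∞)`. -/
lemma strictMonoOn_rpow_mul_exp_neg_inv_rpow {α γ : ℝ} (hα : 0 < α) (hγ : 0 < γ) :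
    StrictMonoOn (fun h : ℝ => h ^ γ * Real.exp (-1 / h ^ α)) (Set.Ioi 0) := by
  intro a ha b hb hab
  have ha' : 0 < a := ha
  have hlt : a ^ γ < b ^ γ := Real.rpow_lt_rpow ha'.le hab hγ
  have hle : Real.exp (-1 / a ^ α) ≤ Real.exp (-1 / b ^ α) := by
    have hpow : 0 < a ^ α := Real.rpow_pos_of_pos ha' α
    have := one_div_le_one_div_of_le hpow (Real.rpow_le_rpow ha'.le hab.le hα.le)
    rw [Real.exp_le_exp, neg_div, neg_div]
    linarith
  exact mul_lt_mul hlt hle (Real.exp_pos _) (Real.rpow_nonneg (ha'.trans hab).le γ)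

/-- The substitution `h = u ^ (-(1 / α))` in `h ^ γ * exp (-1 / h ^ α)`. -/
lemma rpow_mul_exp_neg_inv_rpow_eq {α u : ℝ} (hα : 0 < α) (hu : 0 < u) (γ : ℝ) :
    (u ^ (-(1 / α))) ^ γ * Real.exp (-1 / (u ^ (-(1 / α))) ^ α) =
      Real.exp (-(u + γ / α * Real.log u)) := by
  have hpow : (u ^ (-(1 / α))) ^ α = u⁻¹ := by
    rw [← Real.rpow_mul hu.le, neg_mul, one_div_mul_cancel hα.ne', Real.rpow_neg_one]
  rw [hpow, ← Real.rpow_mul hu.le, Real.rpow_def_of_pos hu, ← Real.exp_add, div_inv_eq_mul]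
  congr 1
  ring

/-- Dividing by a positive constant does not change the growth of `log n`. -/
lemma tendsto_log_div_const_div_log {c : ℝ} (hc : 0 < c) :
    Tendsto (fun n : ℕ => Real.log (n / c) / Real.log n) atTop (nhds 1) := by
  have hlog : Tendsto (fun n : ℕ => Real.log n) atTop atTop :=
    Real.tendsto_log_atTop.comp tendsto_natCast_atTop_atTop
  have h : Tendsto (fun n : ℕ => 1 - Real.log c / Real.log n) atTop (nhds 1) := by
    simpa using (hlog.const_div_atTop (Real.log c)).const_sub 1
  refine h.congr' ?_
  filter_upwards [hlog.eventually_gt_atTop 0, eventually_gt_atTop 0] with n hn hn0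
  have hn0' : (n : ℝ) ≠ 0 := by exact_mod_cast hn0.ne'
  rw [Real.log_div hn0' hc.ne', sub_div, div_self hn.ne']

/-- Bandwidth computation for the `Γ`-varying design example: for large `n` the
equation `h^γ exp(-1/h^α) = c/n` has a smallest positive solution `h_n`, and
`h_n ∼ (log n)^{-1/α}`. -/
theorem statement19 (α γ c : ℝ) (hα : 0 < α) (hγ : 0 < γ) (hc : 0 < c) :
    ∃ hseq : ℕ → ℝ,
      (∀ᶠ n : ℕ in atTop,
        0 < hseq n ∧
          hseq n ^ γ * Real.exp (-1 / hseq n ^ α) = c / n ∧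
          ∀ h' : ℝ, 0 < h' → h' ^ γ * Real.exp (-1 / h' ^ α) = c / n → hseq n ≤ h') ∧
      Filter.Tendsto (fun n : ℕ => hseq n / Real.log n ^ (-(1 / α))) atTop (nhds 1) := by
  have hk : 0 ≤ γ / α := (div_pos hγ hα).le
  choose! U hU using fun y (hy : (1 : ℝ) ≤ y) => exists_add_mul_log_eq hk hy
  have hL : Tendsto (fun n : ℕ => Real.log (n / c)) atTop atTop :=
    Real.tendsto_log_atTop.comp (tendsto_natCast_atTop_atTop.atTop_div_const hc)
  have hlog : Tendsto (fun n : ℕ => Real.log n) atTop atTop :=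
    Real.tendsto_log_atTop.comp tendsto_natCast_atTop_atTop
  refine ⟨fun n => U (Real.log (n / c)) ^ (-(1 / α)), ?_, ?_⟩
  · filter_upwards [hL.eventually_ge_atTop 1, eventually_gt_atTop 0] with n hn hn0
    obtain ⟨h1, h2⟩ := hU _ hn
    have hupos : 0 < U (Real.log (n / c)) := by linarith
    have hpos : 0 < U (Real.log (n / c)) ^ (-(1 / α)) := Real.rpow_pos_of_pos hupos _
    have hn0' : (0 : ℝ) < n := by exact_mod_cast hn0
    have hsol : (U (Real.log (n / c)) ^ (-(1 / α))) ^ γ *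
        Real.exp (-1 / (U (Real.log (n / c)) ^ (-(1 / α))) ^ α) = c / n := by
      rw [rpow_mul_exp_neg_inv_rpow_eq hα hupos, h2, Real.exp_neg,
        Real.exp_log (div_pos hn0' hc), inv_div]
    refine ⟨hpos, hsol, fun h' hh' heq => ?_⟩
    exact ((strictMonoOn_rpow_mul_exp_neg_inv_rpow hα hγ).injOn hpos hh'
      (hsol.trans heq.symm)).le
  · have hratio : Tendsto (fun n : ℕ => U (Real.log (n / c)) / Real.log n) atTop (nhds 1) := by
      have h := ((tendsto_div_of_add_mul_log_eq hk hU).comp hL).mul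
        (tendsto_log_div_const_div_log hc)
      rw [mul_one] at h
      refine h.congr' ?_
      filter_upwards [hL.eventually_gt_atTop 0] with n hn
      exact div_mul_div_cancel₀ hn.ne'
    have h := hratio.rpow_const (p := -(1 / α)) (Or.inl one_ne_zero)
    rw [Real.one_rpow] at h
    refine h.congr' ?_
    filter_upwards [hL.eventually_ge_atTop 1, hlog.eventually_gt_atTop 0] with n hn hn'
    exact Real.div_rpow (zero_le_one.trans (hU _ hn).1) hn'.le _

end
end
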